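/- Let k be a finite field of characteristic p ≥ 5 and let n ≥ 2. Then H^0(GL(n,k), Λ³(gl_n)) is 1-dimensional over k and H^1(GL(n,k), Λ³(gl_n)) = 0, where Λ³(gl_n) denotes the third exterior power of the adjoint representation gl_n. -/

import Mathlib

open scoped MatrixGroups TensorProduct

noncomputable section

/-- The adjoint (conjugation) representation of `GL(n,k)` on `gl_n`. -/
def glConj (k : Type) [Field k] (n : ℕ) :
    Representation k (GL (Fin n) k) (Matrix (Fin n) (Fin n) k) where
  toFun g :=
    { toFun := fun x => (g : Matrix (Fin n) (Fin n) k) * x * (↑g⁻¹ : Matrix (Fin n) (Fin n) k)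
      map_add' := fun x y => by noncomm_ring
      map_smul' := fun c x => by simp [Matrix.smul_mul, Matrix.mul_smul] }
  map_one' := by ext x; simp
  map_mul' g h := by
    ext x
    simp [Matrix.mul_assoc]

variable (k : Type) [Field k] {G : Type} [Group G]
variable (V : Type) [AddCommGroup V] [Module k V]

/-- The `m`-th tensor power of a representation (diagonal action). -/
def tpowRep (m : ℕ) (ρ : Representation k G V) :
    Representation k G (⨂[k] (_ : Fin m), V) :=
  PiTensorProduct.mapMonoidHom.comp (Pi.monoidHom fun _ => ρ)

lemma tpowRep_apply (m : ℕ) (ρ : Representation k G V) (g : G) (f : Fin m → V) :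
    tpowRep k V m ρ g (PiTensorProduct.tprod k f)
      = PiTensorProduct.tprod k (fun i => ρ g (f i)) := by
  exact PiTensorProduct.map_tprod _ _

/-- The subspace of the `m`-th tensor power by which one quotients to obtain
the `m`-th symmetric power. -/
def symPowSub (m : ℕ) : Submodule k (⨂[k] (_ : Fin m), V) :=
  Submodule.span k {z | ∃ (σ : Equiv.Perm (Fin m)) (f : Fin m → V),
    z = PiTensorProduct.tprod k f - PiTensorProduct.tprod k (f ∘ σ)}

/-- The `m`-th symmetric power of a `k`-vector space. -/
abbrev SymPow (m : ℕ) := (⨂[k] (_ : Fin m), V) ⧸ symPowSub k V m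

/-- The `m`-th symmetric power of a representation. -/
def symPowRep (m : ℕ) (ρ : Representation k G V) :
    Representation k G (SymPow k V m) where
  toFun g := Submodule.mapQ _ _ (tpowRep k V m ρ g) (by
    rw [symPowSub, Submodule.span_le]
    rintro z ⟨σ, f, rfl⟩
    simp only [SetLike.mem_coe, Submodule.mem_comap, map_sub, tpowRep_apply]
    refine Submodule.subset_span ⟨σ, fun i => ρ g (f i), ?_⟩
    simp [Function.comp_def])
  map_one' := by
    refine Submodule.linearMap_qext _ ?_
    refine PiTensorProduct.ext ?_
    ext f
    simp [Submodule.mapQ_apply, tpowRep_apply]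
  map_mul' g h := by
    refine Submodule.linearMap_qext _ ?_
    refine PiTensorProduct.ext ?_
    ext f
    simp [Submodule.mapQ_apply, tpowRep_apply]

/-- The subspace of the `m`-th tensor power by which one quotients to obtain
the `m`-th exterior power: the span of pure tensors with two equal entries. -/
def altPowSub (m : ℕ) : Submodule k (⨂[k] (_ : Fin m), V) :=
  Submodule.span k {z | ∃ (f : Fin m → V) (i j : Fin m), i ≠ j ∧ f i = f j ∧
    z = PiTensorProduct.tprod k f}

/-- The `m`-th exterior power of a `k`-vector space. -/
abbrev AltPow (m : ℕ) := (⨂[k] (_ : Fin m), V) ⧸ altPowSub k V m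

/-- The `m`-th exterior power of a representation. -/
def altPowRep (m : ℕ) (ρ : Representation k G V) :
    Representation k G (AltPow k V m) where
  toFun g := Submodule.mapQ _ _ (tpowRep k V m ρ g) (by
    rw [altPowSub, Submodule.span_le]
    rintro z ⟨f, i, j, hij, hfij, rfl⟩
    simp only [SetLike.mem_coe, Submodule.mem_comap, tpowRep_apply]
    exact Submodule.subset_span ⟨fun i => ρ g (f i), i, j, hij, by simp only [hfij], rfl⟩)
  map_one' := by
    refine Submodule.linearMap_qext _ (PiTensorProduct.ext ?_)
    ext f
    simp [Submodule.mapQ_apply, tpowRep_apply]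
  map_mul' g h := by
    refine Submodule.linearMap_qext _ (PiTensorProduct.ext ?_)
    ext f
    simp [Submodule.mapQ_apply, tpowRep_apply]

/-- The second divided power `Γ²V ⊆ V ⊗ V`: tensors invariant under the flip. -/
def gamma2 : Submodule k (V ⊗[k] V) :=
  LinearMap.eqLocus (TensorProduct.comm k V V).toLinearMap LinearMap.id

lemma comm_comp_map (f : V →ₗ[k] V) :
    (TensorProduct.comm k V V).toLinearMap ∘ₗ TensorProduct.map f f
      = TensorProduct.map f f ∘ₗ (TensorProduct.comm k V V).toLinearMap :=
  TensorProduct.ext' fun x y => by simp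

lemma gamma2_stable (f : V →ₗ[k] V) :
    ∀ z ∈ gamma2 k V, TensorProduct.map f f z ∈ gamma2 k V := by
  intro z hz
  have h1 : (TensorProduct.comm k V V).toLinearMap z = z := hz
  have h2 := congrArg (fun φ => φ z) (comm_comp_map k V f)
  simp only [LinearMap.comp_apply] at h2
  rw [h1] at h2
  exact h2

/-- The second divided power of a representation. -/
def gamma2Rep (ρ : Representation k G V) : Representation k G (gamma2 k V) where
  toFun g := ((ρ.tprod ρ) g).restrict (p := gamma2 k V) (q := gamma2 k V)
    (gamma2_stable k V (ρ g))
  map_one' := by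
    ext z
    simp [LinearMap.restrict_apply, Representation.tprod_apply]
  map_mul' g h := by
    ext z
    simp only [LinearMap.restrict_apply, Representation.tprod_apply, map_mul,
      Module.End.mul_apply, LinearMap.coe_mk, AddHom.coe_mk, Submodule.coe_subtype]


namespace GLX

section LinAlg

variable {F : Type} [Field F] {W Y : Type} [AddCommGroup W] [Module F W] [AddCommGroup Y] [Module F Y]

lemma exists_avoid [Fintype F] [DecidableEq F] (l : List (W →ₗ[F] F)) (h0 : ∀ φ ∈ l, φ ≠ 0)
    (hl : l.length < Fintype.card F) : ∃ v : W, ∀ φ ∈ l, φ v ≠ 0 := by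
  induction l with
  | nil => exact ⟨0, by simp⟩
  | cons φ l ih =>
    obtain ⟨v, hv⟩ := ih (fun ψ hψ => h0 ψ (by simp [hψ])) (by simp at hl; omega)
    by_cases hφ : φ v = 0
    · obtain ⟨m, hm⟩ : ∃ m, φ m ≠ 0 := by
        by_contra hc
        push Not at hc
        exact h0 φ (by simp) (LinearMap.ext hc)
      let bad : List F := 0 :: l.map (fun ψ => - ψ v / ψ m)
      obtain ⟨t, ht⟩ : ∃ t, t ∉ bad.toFinset := by
        by_contra hc
        push Not at hc
        have h1 : (Finset.univ : Finset F) ⊆ bad.toFinset := fun x _ => hc x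
        have h2 := Finset.card_le_card h1
        have h3 := bad.toFinset_card_le
        simp [bad] at h3
        simp [bad] at h2
        simp at hl
        omega
      simp only [bad, List.mem_toFinset, List.mem_cons, List.mem_map, not_or, not_exists, not_and] at ht
      refine ⟨v + t • m, ?_⟩
      intro ψ hψ
      simp only [List.mem_cons] at hψ
      rcases hψ with rfl | hψ
      · simp [hφ, hm, ht.1]
      · intro h
        simp at h
        by_cases hz : ψ m = 0
        · simp [hz] at h
          exact hv ψ hψ h
        · apply ht.2 ψ hψ
          field_simp
          linear_combination -h
    · refine ⟨v, ?_⟩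
      intro ψ hψ
      simp only [List.mem_cons] at hψ
      rcases hψ with rfl | hψ
      · exact hφ
      · exact hv ψ hψ

lemma functional_of_ne_top {H : Submodule F W} (h : H ≠ ⊤) :
    ∃ φ : W →ₗ[F] F, φ ≠ 0 ∧ ∀ v ∈ H, φ v = 0 := by
  obtain ⟨φ, h1, h2⟩ := Submodule.exists_le_ker_of_lt_top H (lt_top_iff_ne_top.mpr h)
  exact ⟨φ, h1, fun v hv => h2 hv⟩

/-- a linear map vanishing outside three proper subspaces is zero -/
lemma eq_zero_of_off [Fintype F] (hq : 5 ≤ Fintype.card F) {H1 H2 H3 : Submodule F W}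
    (h1 : H1 ≠ ⊤) (h2 : H2 ≠ ⊤) (h3 : H3 ≠ ⊤) (f : W →ₗ[F] Y)
    (h : ∀ v, v ∉ H1 → v ∉ H2 → v ∉ H3 → f v = 0) : f = 0 := by
  classical
  by_contra hf
  obtain ⟨φ1, a1, b1⟩ := functional_of_ne_top h1
  obtain ⟨φ2, a2, b2⟩ := functional_of_ne_top h2
  obtain ⟨φ3, a3, b3⟩ := functional_of_ne_top h3
  obtain ⟨φ4, a4, b4⟩ := functional_of_ne_top (H := LinearMap.ker f) (by
    intro hc; exact hf (LinearMap.ker_eq_top.mp hc))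
  obtain ⟨v, hv⟩ := exists_avoid [φ1, φ2, φ3, φ4] (by simp [a1, a2, a3, a4]) (by simp; omega)
  simp at hv
  apply hv.2.2.2
  apply b4
  exact h v (fun hc => hv.1 (b1 v hc)) (fun hc => hv.2.1 (b2 v hc)) (fun hc => hv.2.2.1 (b3 v hc))

/-- linear extension off a proper subspace -/
lemma lin_ext {H : Submodule F W} (hH : H ≠ ⊤) (h2 : (2 : F) ≠ 0) (f : W → Y)
    (hadd : ∀ v v', v ∉ H → v' ∉ H → v + v' ∉ H → f (v + v') = f v + f v')
    (hsmul : ∀ (c : F) v, c ≠ 0 → v ∉ H → f (c • v) = c • f v) :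
    ∃ ℓ : W →ₗ[F] Y, ∀ v, v ∉ H → f v = ℓ v := by
  obtain ⟨φ, hφ0, hφ⟩ := functional_of_ne_top hH
  obtain ⟨m, hm⟩ : ∃ m, φ m = 1 := by
    obtain ⟨m, hm⟩ : ∃ m, φ m ≠ 0 := by
      by_contra hc
      push Not at hc
      exact hφ0 (LinearMap.ext hc)
    exact ⟨(φ m)⁻¹ • m, by simp [hm]⟩
  have hn : ∀ v, φ v ≠ 0 → v ∉ H := fun v hv hc => hv (hφ v hc)
  have hadd' : ∀ v v', φ v ≠ 0 → φ v' ≠ 0 → φ v + φ v' ≠ 0 → f (v + v') = f v + f v' :=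
    fun v v' a b c => hadd v v' (hn _ a) (hn _ b) (hn _ (by simpa using c))
  let w : W → W := fun v => v + (1 - φ v) • m
  have hw : ∀ v, φ (w v) = 1 := fun v => by simp [w, hm]
  have haff : ∀ (c : F) (v v' : W), φ v = 1 → φ v' = 1 →
      f (c • v + (1 - c) • v') = c • f v + (1 - c) • f v' := by
    intro c v v' hv hv'
    by_cases hc : c = 0
    · simp [hc]
    by_cases hc1 : c = 1
    · simp [hc1]
    have hc2 : (1 : F) - c ≠ 0 := fun h => hc1 (by linear_combination -h)
    rw [hadd' _ _ (by simp [hv, hc]) (by simp [hv', hc2]) (by simp [hv, hv']),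
      hsmul _ _ hc (hn _ (by simp [hv])), hsmul _ _ hc2 (hn _ (by simp [hv']))]
  let ℓ : W →ₗ[F] Y :=
    { toFun := fun v => f (w v) - (1 - φ v) • f m
      map_add' := by
        intro v v'
        have e1 : w (v + v') + m = w v + w v' := by
          simp only [w, map_add]; module
        have e2 := hadd' (w (v + v')) m (by simp [hw]) (by simp [hm]) (by
          rw [hw, hm]; intro h; apply h2; linear_combination h)
        have e3 := hadd' (w v) (w v') (by simp [hw]) (by simp [hw]) (by
          rw [hw, hw]; intro h; apply h2; linear_combination h)
        rw [e1, e3] at e2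
        have e4 : f (w (v + v')) = f (w v) + f (w v') - f m := by rw [e2]; abel
        simp only [e4, map_add]
        module
      map_smul' := by
        intro c v
        have e1 : w (c • v) = c • w v + (1 - c) • m := by
          simp only [w, map_smul, smul_eq_mul]; module
        simp only [e1, haff c (w v) m (hw v) hm, map_smul, smul_eq_mul, RingHom.id_apply]
        module }
  have hℓ1 : ∀ v, φ v ≠ 0 → f v = ℓ v := by
    intro v hv
    show f v = f (v + (1 - φ v) • m) - (1 - φ v) • f m
    by_cases h1 : (1 - φ v) = 0
    · simp [h1]
    · rw [hadd' _ _ hv (by simp [hm, h1]) (by simp [hm]), hsmul _ _ h1 (hn _ (by simp [hm]))]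
      abel
  refine ⟨ℓ, fun v hv => ?_⟩
  by_cases hv0 : φ v = 0
  · have e : v = m + (v - m) := by abel
    have e5 : φ (v - m) ≠ 0 := by simp [hm, hv0]
    rw [e, hadd m (v - m) (hn _ (by simp [hm])) (hn _ e5) (by rwa [← e]), hℓ1 _ (by simp [hm]),
      hℓ1 _ e5, ← map_add]
  · exact hℓ1 v hv0

variable [Fintype F]

/-- bilinear extension, relative to a subspace `H` -/
lemma bilin_ext (hq : 5 ≤ Fintype.card F) (h2 : (2 : F) ≠ 0) (H : Submodule F W)
    (hH : ∀ v, H ⊔ F ∙ v ≠ ⊤) (f : W → W → Y)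
    (s1 : ∀ v2, ∃ ℓ : W →ₗ[F] Y, ∀ v1, v2 ∉ H → v1 ∉ H ⊔ F ∙ v2 → f v1 v2 = ℓ v1)
    (s2 : ∀ v1, ∃ ℓ : W →ₗ[F] Y, ∀ v2, v2 ∉ H → v1 ∉ H ⊔ F ∙ v2 → f v1 v2 = ℓ v2) :
    ∃ Φ : W →ₗ[F] W →ₗ[F] Y, ∀ v1 v2, v2 ∉ H → v1 ∉ H ⊔ F ∙ v2 → f v1 v2 = Φ v2 v1 := by
  choose ℓ hℓ using s1
  choose m hm using s2
  have hHt : H ≠ ⊤ := fun h => hH 0 (by simp [h])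
  obtain ⟨Φ, hΦ⟩ := lin_ext hHt h2 ℓ (by
      intro v v' hv hv' hvv
      rw [← sub_eq_zero]
      refine eq_zero_of_off hq (hH v) (hH v') (hH (v + v')) _ ?_
      intro x x1 x2 x3
      simp only [LinearMap.sub_apply, LinearMap.add_apply]
      rw [← hℓ v x hv x1, ← hℓ v' x hv' x2, ← hℓ _ x hvv x3, hm x v hv x1, hm x v' hv' x2,
        hm x _ hvv x3, map_add, sub_self]) (by
      intro c v hc hv
      have hv' : c • v ∉ H := fun h => hv (by simpa [hc] using H.smul_mem c⁻¹ h)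
      rw [← sub_eq_zero]
      refine eq_zero_of_off hq (hH v) (hH (c • v)) (hH v) _ ?_
      intro x x1 x2 _
      simp only [LinearMap.sub_apply, LinearMap.smul_apply]
      rw [← hℓ v x hv x1, ← hℓ _ x hv' x2, hm x v hv x1, hm x _ hv' x2, map_smul, sub_self])
  exact ⟨Φ, fun v1 v2 a b => by rw [← hΦ v2 a]; exact hℓ v2 v1 a b⟩

lemma sup_exchange {H : Submodule F W} {x y : W} (hy : y ∉ H) (hx : x ∉ H ⊔ F ∙ y) :
    x ∉ H ∧ y ∉ H ⊔ F ∙ x := by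
  refine ⟨fun h => hx (Submodule.mem_sup_left h), fun h => hx ?_⟩
  obtain ⟨a, ha, b, hb, hab⟩ := Submodule.mem_sup.mp h
  obtain ⟨c, rfl⟩ := Submodule.mem_span_singleton.mp hb
  have hc : c ≠ 0 := by
    rintro rfl
    apply hy
    rw [← hab]; simpa using ha
  have : x = c⁻¹ • (y - a) := by
    rw [← hab]; simp [hc]
  rw [this]
  refine Submodule.smul_mem _ _ (Submodule.sub_mem _ ?_ ?_)
  · exact Submodule.mem_sup_right (Submodule.mem_span_singleton_self y)
  · exact Submodule.mem_sup_left ha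

/-- independence of a triple, stated with spans -/
def Ind (v1 v2 v3 : W) : Prop :=
  v3 ≠ 0 ∧ v2 ∉ (F ∙ v3) ∧ v1 ∉ (F ∙ v3) ⊔ (F ∙ v2)

lemma bilin_zero (hq : 5 ≤ Fintype.card F) (H1 H2 H3 : Submodule F W)
    (h1 : ∀ v, H1 ⊔ F ∙ v ≠ ⊤) (h2 : ∀ v, H2 ⊔ F ∙ v ≠ ⊤) (h3 : ∀ v, H3 ⊔ F ∙ v ≠ ⊤)
    (Φ : W →ₗ[F] W →ₗ[F] Y)
    (h : ∀ v1 v2, v2 ∉ H1 → v2 ∉ H2 → v2 ∉ H3 → v1 ∉ H1 ⊔ F ∙ v2 → v1 ∉ H2 ⊔ F ∙ v2 →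
      v1 ∉ H3 ⊔ F ∙ v2 → Φ v2 v1 = 0) : Φ = 0 := by
  have aux : ∀ H : Submodule F W, (∀ v, H ⊔ F ∙ v ≠ ⊤) → H ≠ ⊤ :=
    fun H hH hc => hH 0 (by simp [hc])
  refine eq_zero_of_off hq (aux _ h1) (aux _ h2) (aux _ h3) _ fun v2 a b c => ?_
  exact eq_zero_of_off hq (h1 v2) (h2 v2) (h3 v2) _ fun v1 a' b' c' => h v1 v2 a b c a' b' c'

lemma trilin_ext (hq : 5 ≤ Fintype.card F) (h2 : (2 : F) ≠ 0)
    (hH : ∀ u v : W, (F ∙ u) ⊔ (F ∙ v) ≠ ⊤) (f : W → W → W → Y)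
    (s1 : ∀ v2 v3, ∃ ℓ : W →ₗ[F] Y, ∀ v1, Ind (F := F) v1 v2 v3 → f v1 v2 v3 = ℓ v1)
    (s2 : ∀ v1 v3, ∃ ℓ : W →ₗ[F] Y, ∀ v2, Ind (F := F) v1 v2 v3 → f v1 v2 v3 = ℓ v2)
    (s3 : ∀ v1 v2, ∃ ℓ : W →ₗ[F] Y, ∀ v3, Ind (F := F) v1 v2 v3 → f v1 v2 v3 = ℓ v3) :
    ∃ Φ : W →ₗ[F] W →ₗ[F] W →ₗ[F] Y, ∀ v1 v2 v3, Ind (F := F) v1 v2 v3 → f v1 v2 v3 = Φ v3 v2 v1 := by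
  have key : ∀ v3 : W, ∃ Φ : W →ₗ[F] W →ₗ[F] Y, ∀ v1 v2, Ind (F := F) v1 v2 v3 →
      f v1 v2 v3 = Φ v2 v1 := by
    intro v3
    by_cases hv : v3 = 0
    · exact ⟨0, fun v1 v2 h => absurd hv h.1⟩
    obtain ⟨Φ, hΦ⟩ := bilin_ext hq h2 (F ∙ v3) (hH v3) (fun v1 v2 => f v1 v2 v3)
      (fun v2 => by
        obtain ⟨ℓ, hℓ⟩ := s1 v2 v3
        exact ⟨ℓ, fun v1 a b => hℓ v1 ⟨hv, a, b⟩⟩)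
      (fun v1 => by
        obtain ⟨ℓ, hℓ⟩ := s2 v1 v3
        exact ⟨ℓ, fun v2 a b => hℓ v2 ⟨hv, a, b⟩⟩)
    exact ⟨Φ, fun v1 v2 h => hΦ v1 v2 h.2.1 h.2.2⟩
  choose B hB using key
  choose m hm using s3
  have hbot : (⊥ : Submodule F W) ≠ ⊤ := by
    intro h
    apply hH 0 0
    simpa using h
  obtain ⟨Φ, hΦ⟩ := lin_ext hbot h2 B (by
      intro v v' hv hv' hvv
      simp only [Submodule.mem_bot] at hv hv' hvv
      rw [← sub_eq_zero]
      refine bilin_zero hq _ _ _ (hH v) (hH v') (hH (v + v')) _ ?_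
      intro x y y1 y2 y3 x1 x2 x3
      simp only [LinearMap.sub_apply, LinearMap.add_apply]
      rw [← hB v x y ⟨hv, y1, x1⟩, ← hB v' x y ⟨hv', y2, x2⟩, ← hB _ x y ⟨hvv, y3, x3⟩,
        hm x y v ⟨hv, y1, x1⟩, hm x y v' ⟨hv', y2, x2⟩, hm x y _ ⟨hvv, y3, x3⟩, map_add, sub_self]) (by
      intro c v hc hv
      simp only [Submodule.mem_bot] at hv
      have hcv : c • v ≠ 0 := smul_ne_zero hc hv
      rw [← sub_eq_zero]
      refine bilin_zero hq _ _ _ (hH v) (hH (c • v)) (hH v) _ ?_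
      intro x y y1 y2 y3 x1 x2 x3
      simp only [LinearMap.sub_apply, LinearMap.smul_apply]
      rw [← hB v x y ⟨hv, y1, x1⟩, ← hB _ x y ⟨hcv, y2, x2⟩,
        hm x y v ⟨hv, y1, x1⟩, hm x y _ ⟨hcv, y2, x2⟩, map_smul, sub_self])
  refine ⟨Φ, fun v1 v2 v3 h => ?_⟩
  rw [← hΦ v3 (by simpa using h.1)]
  exact hB v3 v1 v2 h

lemma trilin_zero (hq : 5 ≤ Fintype.card F)
    (hH : ∀ u v : W, (F ∙ u) ⊔ (F ∙ v) ≠ ⊤) (Φ : W →ₗ[F] W →ₗ[F] W →ₗ[F] Y)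
    (h : ∀ v1 v2 v3, Ind (F := F) v1 v2 v3 → Φ v3 v2 v1 = 0) : Φ = 0 := by
  have hbot : (⊥ : Submodule F W) ≠ ⊤ := by
    intro h
    apply hH 0 0
    simpa using h
  refine eq_zero_of_off hq hbot hbot hbot _ fun v3 a _ _ => ?_
  exact bilin_zero hq _ _ _ (hH v3) (hH v3) (hH v3) _ fun v1 v2 b _ _ c _ _ =>
    h v1 v2 v3 ⟨by simpa using a, b, c⟩

end LinAlg

set_option linter.unusedSectionVars false
set_option linter.unusedSimpArgs false
section Mats

variable {F : Type} [Field F] {ι : Type} [Fintype ι] [DecidableEq ι] {a : ℕ}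

def K (g : Matrix ι ι F) : Matrix (Fin a → ι) (Fin a → ι) F :=
  Matrix.of fun I J => ∏ s, g (I s) (J s)

lemma K_apply (g : Matrix ι ι F) (I J : Fin a → ι) : K g I J = ∏ s, g (I s) (J s) := rfl

lemma K_mul (g h : Matrix ι ι F) : (K (g * h) : Matrix (Fin a → ι) (Fin a → ι) F) = K g * K h := by
  ext I J
  simp only [K_apply, Matrix.mul_apply]
  rw [Finset.prod_univ_sum, Fintype.piFinset_univ]
  simp [Finset.prod_mul_distrib]

lemma K_diagonal (t : ι → F) : (K (Matrix.diagonal t) : Matrix (Fin a → ι) (Fin a → ι) F) =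
    Matrix.diagonal fun I => ∏ s, t (I s) := by
  ext I J
  by_cases h : I = J
  · subst h; simp [K_apply]
  · rw [Matrix.diagonal_apply_ne _ h, K_apply]
    obtain ⟨s, hs⟩ := Function.ne_iff.1 h
    exact Finset.prod_eq_zero (Finset.mem_univ s) (Matrix.diagonal_apply_ne _ hs)

lemma K_one : (K (1 : Matrix ι ι F) : Matrix (Fin a → ι) (Fin a → ι) F) = 1 := by
  rw [← Matrix.diagonal_one, K_diagonal]; simp

/-- pure tensors as functions on words -/
def pur : MultilinearMap F (fun _ : Fin a => ι → F) ((Fin a → ι) → F) :=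
  MultilinearMap.pi fun I =>
    (MultilinearMap.mkPiAlgebra F (Fin a) F).compLinearMap fun s => LinearMap.proj (I s)

lemma pur_apply (v : Fin a → ι → F) (I : Fin a → ι) : pur v I = ∏ s, v s (I s) := by
  simp [pur]

lemma pur_single (J : Fin a → ι) :
    pur (fun s => Pi.single (J s) (1 : F)) = Pi.single J 1 := by
  ext I
  rw [pur_apply]
  by_cases h : I = J
  · subst h; simp
  · rw [Pi.single_eq_of_ne h]
    obtain ⟨s, hs⟩ := Function.ne_iff.1 h
    exact Finset.prod_eq_zero (Finset.mem_univ s) (Pi.single_eq_of_ne hs _)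

lemma K_mulVec_pur (g : Matrix ι ι F) (v : Fin a → ι → F) :
    Matrix.mulVec (K g) (pur v) = pur fun s => Matrix.mulVec g (v s) := by
  ext I
  simp only [pur_apply, Matrix.mulVec, dotProduct, K_apply]
  rw [Finset.prod_univ_sum, Fintype.piFinset_univ]
  simp [Finset.prod_mul_distrib]

def U (j : ι) (y : ι → F) : GL ι F where
  val := 1 + Matrix.vecMulVec (Function.update y j 0) (Pi.single j 1)
  inv := 1 + Matrix.vecMulVec (Function.update (-y) j 0) (Pi.single j 1)
  val_inv := by
    rw [mul_add, add_mul, add_mul, Matrix.vecMulVec_mul_vecMulVec]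
    ext i l
    by_cases h : i = j
    · subst h; simp [Matrix.vecMulVec_apply]
    · simp [Matrix.vecMulVec_apply, h]
  inv_val := by
    rw [mul_add, add_mul, add_mul, Matrix.vecMulVec_mul_vecMulVec]
    ext i l
    by_cases h : i = j
    · subst h; simp [Matrix.vecMulVec_apply]
    · simp [Matrix.vecMulVec_apply, h]

lemma U_apply (j : ι) (y : ι → F) (i l : ι) :
    (U j y : Matrix ι ι F) i l = if i = l then 1 else if l = j then y i else 0 := by
  simp only [U, Matrix.add_apply, Matrix.one_apply, Matrix.vecMulVec_apply]
  by_cases h : i = l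
  · subst h
    by_cases h2 : i = j
    · subst h2; simp
    · simp [h2]
  · by_cases h2 : l = j
    · subst h2; simp [h]
    · simp [h, h2]

lemma U_mul (j : ι) (y z : ι → F) : U j y * U j z = U j (y + z) := by
  apply Units.ext
  simp only [U, Units.val_mul]
  rw [mul_add, add_mul, add_mul, Matrix.vecMulVec_mul_vecMulVec]
  ext i l
  by_cases h : i = j
  · subst h; simp [Matrix.vecMulVec_apply]
  · simp [Matrix.vecMulVec_apply, h]; ring

def dg (t : ι → Fˣ) : GL ι F where
  val := Matrix.diagonal fun i => (t i : F)
  inv := Matrix.diagonal fun i => ((t i)⁻¹ : Fˣ)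
  val_inv := by simp
  inv_val := by simp

lemma dg_val (t : ι → Fˣ) : (dg t : Matrix ι ι F) = Matrix.diagonal fun i => (t i : F) := rfl

lemma dg_mul (t u : ι → Fˣ) : dg t * dg u = dg (t * u) := by
  apply Units.ext; simp [dg_val]

lemma dg_U (t : ι → Fˣ) (j : ι) (y : ι → F) :
    dg t * U j y = U j (fun i => (t i : F) * ((t j)⁻¹ : Fˣ) * y i) * dg t := by
  apply Units.ext
  ext i l
  simp only [Units.val_mul, dg_val, Matrix.diagonal_mul, Matrix.mul_diagonal, U_apply]
  by_cases h : i = l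
  · subst h; simp
  · by_cases h2 : l = j
    · subst h2; simp [h]; field_simp
    · simp [h, h2]

def cnt (j : ι) (I : Fin a → ι) : ℕ := (Finset.univ.filter fun s => I s = j).card

lemma cnt_le (j : ι) (I : Fin a → ι) : cnt j I ≤ a := by
  have := Finset.card_filter_le (Finset.univ : Finset (Fin a)) (fun s => I s = j)
  simpa [cnt] using this

lemma K_U_diag (j : ι) (y : ι → F) (I : Fin a → ι) : K (U j y : Matrix ι ι F) I I = 1 := by
  simp [K_apply, U_apply]

lemma K_U_lt (j : ι) (y : ι → F) (I L : Fin a → ι) (h : K (U j y : Matrix ι ι F) I L ≠ 0)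
    (hne : I ≠ L) : cnt j I < cnt j L := by
  have h1 : ∀ s, I s = L s ∨ L s = j := by
    intro s
    by_contra hc
    push Not at hc
    apply h
    rw [K_apply]
    exact Finset.prod_eq_zero (Finset.mem_univ s) (by simp [U_apply, hc.1, hc.2])
  obtain ⟨s, hs⟩ := Function.ne_iff.1 hne
  apply Finset.card_lt_card
  refine Finset.ssubset_iff_subset_ne.2 ⟨?_, ?_⟩
  · intro r hr
    simp only [Finset.mem_filter, Finset.mem_univ, true_and] at hr ⊢
    rcases h1 r with h | h
    · rw [← h, hr]
    · exact h
  · intro he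
    have : s ∈ Finset.univ.filter fun s => L s = j := by
      simpa using (h1 s).resolve_left hs
    rw [← he] at this
    simp only [Finset.mem_filter, Finset.mem_univ, true_and] at this
    exact hs (this.trans ((h1 s).resolve_left hs).symm)

lemma prod_update (l : ι) (r : Fˣ) (I : Fin a → ι) :
    ∏ s, ((Function.update (1 : ι → Fˣ) l r (I s) : Fˣ) : F) = (r : F) ^ cnt l I := by
  have : ∀ s, ((Function.update (1 : ι → Fˣ) l r (I s) : Fˣ) : F) = if I s = l then (r : F) else 1 := by
    intro s
    by_cases h : I s = l
    · simp [h]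
    · simp [h]
  simp only [this, cnt]
  rw [Finset.prod_ite]; simp

structure IsDer (d : GL ι F → Matrix (Fin a → ι) (Fin a → ι) F) : Prop where
  mul : ∀ g h, d (g * h) = d g * K (h : Matrix ι ι F) + K (g : Matrix ι ι F) * d h
  tor : ∀ t, d (dg t) = 0
  top : a = 3 → ∀ i j : ι, i ≠ j → ∀ x : F, d (U j (Pi.single i x)) (fun _ => j) (fun _ => i) = 0
  two : (2 : F) ≠ 0
  three : (3 : F) ≠ 0
  seven : (7 : F) ≠ 0 ∨ (26 : F) ≠ 0
  le : a ≤ 3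

variable {d : GL ι F → Matrix (Fin a → ι) (Fin a → ι) F}

lemma IsDer.one (hd : IsDer d) : d 1 = 0 := by
  have h := hd.mul 1 1
  simpa [K_one] using h

lemma U_zero (j : ι) : U j (0 : ι → F) = 1 := by
  apply Units.ext
  ext i l
  simp [U_apply, Matrix.one_apply]

lemma U_single_self (j : ι) (x : F) : U j (Pi.single j x : ι → F) = 1 := by
  apply Units.ext
  ext i l
  rw [U_apply]
  by_cases h : i = l
  · simp [h]
  · by_cases h2 : l = j
    · subst h2; simp [h]
    · simp [h, h2]

lemma IsDer.torus (hd : IsDer d) (t : ι → Fˣ) (j : ι) (y : ι → F) (I J : Fin a → ι) :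
    (∏ s, (t (I s) : F)) * d (U j y) I J =
      d (U j (fun i => (t i : F) * ((t j)⁻¹ : Fˣ) * y i)) I J * ∏ s, (t (J s) : F) := by
  have h := congrArg d (dg_U t j y)
  rw [hd.mul, hd.mul, hd.tor, zero_mul, mul_zero, zero_add, add_zero, dg_val, K_diagonal] at h
  have := congrFun (congrFun h I) J
  simpa [Matrix.diagonal_mul, Matrix.mul_diagonal] using this

lemma IsDer.scale (hd : IsDer d) (j : ι) (s : Fˣ) (z : ι → F) (I J : Fin a → ι) :
    (s : F) ^ cnt j I * d (U j ((s : F) • z)) I J = d (U j z) I J * (s : F) ^ cnt j J := by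
  have h := hd.torus (Function.update 1 j s) j ((s : F) • z) I J
  rw [prod_update, prod_update] at h
  rw [h]
  congr 2
  have : U j (fun i => ((Function.update (1 : ι → Fˣ) j s i : Fˣ) : F) *
      (((Function.update (1 : ι → Fˣ) j s j)⁻¹ : Fˣ) : F) * (((s : F) • z) i)) = U j z := by
    apply Units.ext
    ext i l
    rw [U_apply, U_apply]
    by_cases hil : i = l
    · simp [hil]
    · by_cases h2 : l = j
      · subst h2; simp [hil]
      · simp [hil, h2]
  rw [this]

lemma IsDer.step (hd : IsDer d) (j : ι) (I J : Fin a → ι)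
    (H1 : ∀ L, cnt j L < cnt j J → ∀ y, d (U j y) I L = 0)
    (H2 : ∀ L, cnt j I < cnt j L → ∀ y, d (U j y) L J = 0) (y z : ι → F) :
    d (U j (y + z)) I J = d (U j y) I J + d (U j z) I J := by
  rw [← U_mul, hd.mul, Matrix.add_apply, Matrix.mul_apply, Matrix.mul_apply]
  congr 1
  · rw [Finset.sum_eq_single J]
    · rw [K_U_diag, mul_one]
    · intro L _ hL
      by_cases hK : K (U j z : Matrix ι ι F) L J = 0
      · rw [hK, mul_zero]
      · rw [H1 L (K_U_lt j z L J hK hL), zero_mul]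
    · simp
  · rw [Finset.sum_eq_single I]
    · rw [K_U_diag, one_mul]
    · intro L _ hL
      by_cases hK : K (U j y : Matrix ι ι F) I L = 0
      · rw [hK, zero_mul]
      · rw [H2 L (K_U_lt j y I L hK (Ne.symm hL)), mul_zero]
    · simp

lemma IsDer.kill (hd : IsDer d) (m : ℕ) (hm : m < 3) (x : F)
    (h2 : x * (2 : F) ^ (m + 1) = x) (h3 : x * (3 : F) ^ (m + 1) = x) : x = 0 := by
  have h2' : x * (2 ^ (m + 1) - 1) = 0 := by rw [mul_sub, h2]; ring
  have h3' : x * (3 ^ (m + 1) - 1) = 0 := by rw [mul_sub, h3]; ring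
  interval_cases m
  · norm_num at h2'; exact h2'
  · norm_num at h2'; exact h2'.resolve_right hd.three
  · norm_num at h2' h3'
    rcases hd.seven with h | h
    · exact h2'.resolve_right h
    · exact h3'.resolve_right h

lemma IsDer.vanish (hd : IsDer d) (j : ι) (I J : Fin a → ι)
    (hadd : ∀ y z, d (U j (y + z)) I J = d (U j y) I J + d (U j z) I J)
    (h1 : cnt j J ≤ cnt j I) (h3 : cnt j I < cnt j J + 3) (y : ι → F) : d (U j y) I J = 0 := by
  obtain ⟨m, hm⟩ := Nat.exists_eq_add_of_le h1
  have e2 : d (U j ((2 : F) • y)) I J = 2 * d (U j y) I J := by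
    rw [two_smul, hadd, two_mul]
  have e3 : d (U j ((3 : F) • y)) I J = 3 * d (U j y) I J := by
    have : (3 : F) • y = y + y + y := by ext i; simp; ring
    rw [this, hadd, hadd]; ring
  have s2 := hd.scale j (Units.mk0 2 hd.two) y I J
  have s3 := hd.scale j (Units.mk0 3 hd.three) y I J
  simp only [Units.val_mk0] at s2 s3
  rw [e2, hm] at s2
  rw [e3, hm] at s3
  refine hd.kill m (by omega) _ ?_ ?_
  · have := pow_ne_zero (cnt j J) hd.two
    apply mul_right_cancel₀ this
    rw [← s2]; ring
  · have := pow_ne_zero (cnt j J) hd.three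
    apply mul_right_cancel₀ this
    rw [← s3]; ring

lemma IsDer.P0 (hd : IsDer d) (j : ι) (J : Fin a → ι) (hJ : cnt j J = 0) :
    ∀ (m : ℕ) (I : Fin a → ι), a ≤ cnt j I + m → ∀ y, d (U j y) I J = 0 := by
  intro m
  induction m with
  | zero =>
    intro I hI
    have hadd := hd.step j I J (by intro L hL; omega)
      (by intro L hL; have := cnt_le j L; omega)
    by_cases h3 : cnt j I < 3
    · exact hd.vanish j I J hadd (by omega) (by omega)
    have ha : a = 3 := by have := cnt_le j I; have := hd.le; omega
    have hIj : I = fun _ => j := by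
      have : (Finset.univ.filter fun s => I s = j) = Finset.univ := by
        apply Finset.eq_univ_of_card
        simp only [Fintype.card_fin]
        have := cnt_le j I
        unfold cnt at this hI
        omega
      ext s
      have h : s ∈ Finset.univ.filter fun s => I s = j := by rw [this]; simp
      simpa using h
    intro y
    let f : (ι → F) →+ F :=
      { toFun := fun y => d (U j y) I J
        map_zero' := by rw [U_zero, hd.one]; rfl
        map_add' := hadd }
    change f y = 0
    rw [← Finset.univ_sum_single y, map_sum]
    apply Finset.sum_eq_zero
    intro i _
    change d (U j (Pi.single i (y i))) I J = 0
    by_cases hij : i = j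
    · subst hij; rw [U_single_self, hd.one]; rfl
    by_cases hJi : J = fun _ => i
    · rw [hIj, hJi]; exact hd.top ha i j hij _
    · obtain ⟨s, hs⟩ := Function.ne_iff.1 hJi
      have hmem : ∀ s, J s ≠ j := by
        intro s hs
        have : 0 < cnt j J := Finset.card_pos.2 ⟨s, by simpa using hs⟩
        omega
      have hc : 0 < cnt (J s) J := Finset.card_pos.2 ⟨s, by simp⟩
      have hc3 := cnt_le (J s) J
      have hI0 : cnt (J s) I = 0 := by
        rw [cnt, Finset.card_eq_zero, Finset.filter_eq_empty_iff]
        intro r _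
        rw [hIj]
        exact fun h => hmem s h.symm
      have key : ∀ r : Fˣ, d (U j (Pi.single i (y i))) I J * (r : F) ^ cnt (J s) J =
          d (U j (Pi.single i (y i))) I J := by
        intro r
        have h := hd.torus (Function.update 1 (J s) r) j (Pi.single i (y i)) I J
        rw [prod_update, prod_update, hI0, pow_zero, one_mul] at h
        have hh : (fun l => ((Function.update (1 : ι → Fˣ) (J s) r l : Fˣ) : F) *
          (((Function.update (1 : ι → Fˣ) (J s) r j)⁻¹ : Fˣ) : F) *
          ((Pi.single i (y i) : ι → F) l)) = Pi.single i (y i) := by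
          ext l
          by_cases hl : l = i
          · subst hl
            rw [Function.update_of_ne (Ne.symm hs), Function.update_of_ne (Ne.symm (hmem s))]
            simp
          · simp [hl]
        rw [hh] at h
        exact h.symm
      obtain ⟨m, hm⟩ : ∃ m, cnt (J s) J = m + 1 := ⟨cnt (J s) J - 1, by omega⟩
      rw [hm] at key
      exact hd.kill m (by omega) _ (key (Units.mk0 2 hd.two)) (key (Units.mk0 3 hd.three))
  | succ m ih =>
    intro I hI
    have hadd := hd.step j I J (by intro L hL; omega)
      (by intro L hL; exact ih L (by omega))
    by_cases h3 : cnt j I < 3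
    · exact hd.vanish j I J hadd (by omega) (by omega)
    · exact ih I (by have := hd.le; omega)

lemma IsDer.P0_vec (hd : IsDer d) (j : ι) (J : Fin a → ι) (hJ : cnt j J = 0) (y : ι → F) :
    Matrix.mulVec (d (U j y)) (Pi.single J 1) = 0 := by
  ext I
  simp [hd.P0 j J hJ a I (by omega) y]

lemma IsDer.P1 (hd : IsDer d) (j : ι) (J : Fin a → ι) (hJ : cnt j J = 1) :
    ∀ (m : ℕ) (I : Fin a → ι), a ≤ cnt j I + m → 1 ≤ cnt j I → ∀ y, d (U j y) I J = 0 := by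
  intro m
  induction m with
  | zero =>
    intro I hI h1
    have hadd := hd.step j I J (by intro L hL; exact hd.P0 j L (by omega) a I (by omega))
      (by intro L hL; have := cnt_le j L; omega)
    exact hd.vanish j I J hadd (by omega) (by have := hd.le; have := cnt_le j I; omega)
  | succ m ih =>
    intro I hI h1
    have hadd := hd.step j I J (by intro L hL; exact hd.P0 j L (by omega) a I (by omega))
      (by intro L hL; exact ih L (by omega) (by omega))
    exact hd.vanish j I J hadd (by omega) (by have := hd.le; have := cnt_le j I; omega)

lemma IsDer.P1_lin (hd : IsDer d) (j : ι) (J : Fin a → ι) (hJ : cnt j J = 1) :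
    ∃ φ : (ι → F) →ₗ[F] ((Fin a → ι) → F), ∀ z,
      Matrix.mulVec (d (U j z)) (Pi.single J 1) = φ z := by
  refine ⟨
    { toFun := fun z => Matrix.mulVec (d (U j z)) (Pi.single J 1)
      map_add' := ?_
      map_smul' := ?_ }, fun z => rfl⟩
  · intro y z
    ext I
    simp only [Matrix.mulVec_single_one, Pi.add_apply, Matrix.col_apply]
    exact hd.step j I J (by intro L hL; exact hd.P0 j L (by omega) a I (by omega))
      (by intro L hL; exact hd.P1 j J hJ a L (by omega) (by omega)) y z
  · intro s z
    ext I
    simp only [Matrix.mulVec_single_one, Pi.smul_apply, Matrix.col_apply, RingHom.id_apply, smul_eq_mul]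
    by_cases hs : s = 0
    · subst hs; rw [zero_smul, U_zero, hd.one]; simp
    by_cases hc : 1 ≤ cnt j I
    · rw [hd.P1 j J hJ a I (by omega) hc, hd.P1 j J hJ a I (by omega) hc, mul_zero]
    · have := hd.scale j (Units.mk0 s hs) z I J
      rw [hJ, show cnt j I = 0 by omega] at this
      simp only [Units.val_mk0, pow_zero, one_mul, pow_one] at this
      rw [this, mul_comm]

end Mats

set_option linter.unusedSectionVars false
set_option linter.unusedSimpArgs false
section Gens

variable {F : Type} [Field F] {ι : Type} [Fintype ι] [DecidableEq ι] {a : ℕ}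

/-- action of GL on column vectors -/
abbrev act (g : GL ι F) (v : ι → F) : ι → F := Matrix.mulVec (g : Matrix ι ι F) v

abbrev eb (j : ι) : ι → F := Pi.single j 1

lemma act_mul (g h : GL ι F) (v : ι → F) : act (g * h) v = act g (act h v) := by
  simp [act, Matrix.mulVec_mulVec]

lemma act_one (v : ι → F) : act 1 v = v := by simp [act]

lemma act_inv_act (g : GL ι F) (v : ι → F) : act g⁻¹ (act g v) = v := by
  rw [← act_mul]; simp [act_one]

lemma act_act_inv (g : GL ι F) (v : ι → F) : act g (act g⁻¹ v) = v := by
  rw [← act_mul]; simp [act_one]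

lemma act_U (j : ι) (y v : ι → F) : act (U j y) v = v + v j • Function.update y j 0 := by
  simp only [act, U, Matrix.add_mulVec, Matrix.one_mulVec, Matrix.vecMulVec_mulVec]
  simp

lemma act_U_of_ne (j l : ι) (h : l ≠ j) (y : ι → F) : act (U j y) (eb l) = eb l := by
  rw [act_U]; simp [eb, h.symm]

lemma act_dg_of_ne (j l : ι) (h : l ≠ j) (s : Fˣ) :
    act (dg (Function.update 1 j s)) (eb l : ι → F) = eb l := by
  ext i
  simp only [act, dg_val, Matrix.mulVec_diagonal, eb]
  by_cases hi : i = l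
  · subst hi; simp [h]
  · simp [hi]

lemma act_h_self (j : ι) (z : ι → F) (hz : z j ≠ 0) :
    act (U j ((z j)⁻¹ • z) * dg (Function.update 1 j (Units.mk0 (z j) hz))) (eb j) = z := by
  rw [act_mul]
  have : act (dg (Function.update 1 j (Units.mk0 (z j) hz))) (eb j : ι → F) = z j • eb j := by
    ext i
    simp only [act, dg_val, Matrix.mulVec_diagonal, eb]
    by_cases hi : i = j
    · subst hi; simp
    · simp [hi]
  rw [this, act_U]
  ext i
  by_cases hi : i = j
  · subst hi; simp
  · simp [hi, hz]

lemma lemX (S : Subgroup (GL ι F)) (A : Finset ι) (hU : ∀ j ∉ A, ∀ y, U j y ∈ S)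
    (hT : ∀ j ∉ A, ∀ s, dg (Function.update 1 j s) ∈ S) (z : ι → F) (i j : ι) (hi : i ∉ A)
    (hj : j ∉ A) (hz : z i ≠ 0) : ∃ h ∈ S, (∀ b ∈ A, act h (eb b) = eb b) ∧ act h (eb j) = z := by
  have case1 : ∀ z : ι → F, z j ≠ 0 →
      ∃ h ∈ S, (∀ b ∈ A, act h (eb b) = eb b) ∧ act h (eb j) = z := by
    intro z hz
    refine ⟨_, S.mul_mem (hU j hj ((z j)⁻¹ • z)) (hT j hj (Units.mk0 (z j) hz)), ?_, act_h_self j z hz⟩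
    intro b hb
    have hbj : b ≠ j := fun h => hj (h ▸ hb)
    rw [act_mul, act_dg_of_ne _ _ hbj, act_U_of_ne _ _ hbj]
  by_cases hzj : z j = 0
  · have hij : i ≠ j := by rintro rfl; exact hz hzj
    obtain ⟨h, hS, hA, he⟩ := case1 (z + z i • eb j) (by simp [hzj, hz])
    refine ⟨U i (-eb j) * h, S.mul_mem (hU i hi _) hS, ?_, ?_⟩
    · intro b hb
      have hbi : b ≠ i := fun h => hi (h ▸ hb)
      rw [act_mul, hA b hb, act_U_of_ne _ _ hbi]
    · rw [act_mul, he, act_U]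
      ext l
      by_cases hl : l = i
      · subst hl; simp [hij]
      · simp [hl, hij]
  · exact case1 z hzj

lemma gl_ext {g h : GL ι F} (H : ∀ b, act g (eb b) = act h (eb b)) : g = h := by
  apply Units.ext
  ext i j
  have := congrFun (H j) i
  simpa [act, eb] using this

lemma gen_aux (S : Subgroup (GL ι F)) : ∀ (m : ℕ) (A : Finset ι), Aᶜ.card = m →
    (∀ j ∉ A, ∀ y, U j y ∈ S) → (∀ j ∉ A, ∀ s, dg (Function.update 1 j s) ∈ S) →
    ∀ g : GL ι F, (∀ b ∈ A, act g (eb b) = eb b) → g ∈ S := by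
  intro m
  induction m with
  | zero =>
    intro A hA _ _ g hg
    have : A = Finset.univ := by simpa using hA
    subst this
    have : g = 1 := gl_ext fun b => by rw [hg b (Finset.mem_univ _), act_one]
    rw [this]; exact S.one_mem
  | succ m ih =>
    intro A hA hU hT g hg
    obtain ⟨j, hj⟩ : ∃ j, j ∈ Aᶜ := Finset.card_pos.1 (by omega)
    have hj' : j ∉ A := by simpa using hj
    obtain ⟨i, hi, hz⟩ : ∃ i ∉ A, act g (eb j) i ≠ 0 := by
      by_contra hc
      push Not at hc
      have h1 : act g (act g (eb j)) = act g (eb j) := by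
        set z := act g (eb j) with hzdef
        have hsum : z = ∑ b, z b • (eb b : ι → F) := by
          ext i; simp [eb, Finset.sum_apply, Pi.single_apply]
        conv_lhs => rw [hsum]
        conv_rhs => rw [hsum]
        simp only [act, Matrix.mulVec_sum, Matrix.mulVec_smul]
        apply Finset.sum_congr rfl
        intro b _
        by_cases hb : b ∈ A
        · exact congrArg (z b • ·) (hg b hb)
        · rw [hc b hb]; simp
      have h2 := congrArg (act g⁻¹) h1
      rw [act_inv_act, act_inv_act] at h2
      have := hc j hj'
      rw [h2] at this
      simp [eb] at this
    obtain ⟨h, hS, hfix, he⟩ := lemX S A hU hT _ i j hi hj' hz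
    have key : h⁻¹ * g ∈ S := by
      refine ih (insert j A) ?_ (fun l hl => hU l fun hc => hl (Finset.mem_insert_of_mem hc))
        (fun l hl => hT l fun hc => hl (Finset.mem_insert_of_mem hc)) _ ?_
      · rw [Finset.compl_insert, Finset.card_erase_of_mem hj]; omega
      · intro b hb
        rw [act_mul]
        rcases Finset.mem_insert.1 hb with rfl | hb
        · rw [← he, act_inv_act]
        · rw [hg b hb]
          conv_lhs => rw [← hfix b hb]
          rw [act_inv_act]
    have := S.mul_mem hS key
    simpa using this

variable {d : GL ι F → Matrix (Fin a → ι) (Fin a → ι) F}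

def tup (J0 : Fin a → ι) (g : GL ι F) : Fin a → ι → F := fun s => act g (eb (J0 s))

lemma K_tup (J0 : Fin a → ι) (g h : GL ι F) :
    Matrix.mulVec (K (g : Matrix ι ι F)) (pur (tup J0 h)) = pur (tup J0 (g * h)) := by
  rw [K_mulVec_pur]
  congr 1
  ext1 s
  simp only [tup, act_mul]

lemma pur_tup_one (J0 : Fin a → ι) : pur (tup J0 (1 : GL ι F)) = Pi.single J0 1 := by
  rw [← pur_single]; congr 1; ext1 s; simp only [tup, act_one]

lemma K_e0 (J0 : Fin a → ι) (g : GL ι F) :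
    Matrix.mulVec (K (g : Matrix ι ι F)) (Pi.single J0 1) = pur (tup J0 g) := by
  rw [← pur_tup_one, K_tup, mul_one]

lemma IsDer.mulVec (hd : IsDer d) (g h : GL ι F) (v) :
    Matrix.mulVec (d (g * h)) v = Matrix.mulVec (d g) (Matrix.mulVec (K (h : Matrix ι ι F)) v) +
      Matrix.mulVec (K (g : Matrix ι ι F)) (Matrix.mulVec (d h) v) := by
  rw [hd.mul, Matrix.add_mulVec, Matrix.mulVec_mulVec, Matrix.mulVec_mulVec]

def stab (hd : IsDer d) (J0 : Fin a → ι) : Subgroup (GL ι F) where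
  carrier := {g | Matrix.mulVec (K (g : Matrix ι ι F)) (Pi.single J0 1) = Pi.single J0 1 ∧
    Matrix.mulVec (d g) (Pi.single J0 1) = 0}
  one_mem' := by
    constructor
    · rw [Units.val_one, K_one, Matrix.one_mulVec]
    · rw [hd.one, Matrix.zero_mulVec]
  mul_mem' := by
    rintro g h ⟨hg, hg'⟩ ⟨hh, hh'⟩
    constructor
    · rw [Units.val_mul, K_mul, ← Matrix.mulVec_mulVec, hh, hg]
    · rw [hd.mulVec, hh, hg', hh']; simp
  inv_mem' := by
    rintro g ⟨hg, hg'⟩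
    constructor
    · conv_lhs => rw [← hg]
      rw [Matrix.mulVec_mulVec, ← K_mul, ← Units.val_mul, inv_mul_cancel, Units.val_one, K_one,
        Matrix.one_mulVec]
    · have := hd.mulVec g⁻¹ g (Pi.single J0 1)
      rw [hg, hg', inv_mul_cancel, hd.one, Matrix.zero_mulVec, Matrix.mulVec_zero,
        add_zero] at this
      exact this.symm

lemma cnt_zero (J0 : Fin a → ι) (j : ι) (h : ∀ s, J0 s ≠ j) : cnt j J0 = 0 := by
  rw [cnt, Finset.card_eq_zero, Finset.filter_eq_empty_iff]
  exact fun s _ => h s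

lemma cnt_one (J0 : Fin a → ι) (hJ : Function.Injective J0) (s : Fin a) : cnt (J0 s) J0 = 1 := by
  rw [cnt, Finset.card_eq_one]
  exact ⟨s, by ext r; simp [hJ.eq_iff]⟩

lemma IsDer.F_dep (hd : IsDer d) (J0 : Fin a → ι) (g h : GL ι F) (H : tup J0 g = tup J0 h) :
    Matrix.mulVec (d g) (Pi.single J0 1) = Matrix.mulVec (d h) (Pi.single J0 1) := by
  have hmem : g⁻¹ * h ∈ stab hd J0 := by
    refine gen_aux (stab hd J0) _ (Finset.univ.image J0) rfl ?_ ?_ _ ?_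
    · intro j hj y
      have hj' : ∀ s, J0 s ≠ j := fun s hs => hj (by simp [← hs])
      refine ⟨?_, hd.P0_vec j J0 (cnt_zero J0 j hj') y⟩
      rw [K_e0, ← pur_single]
      congr 1
      ext1 s
      exact act_U_of_ne _ _ (hj' s) y
    · intro j hj t
      have hj' : ∀ s, J0 s ≠ j := fun s hs => hj (by simp [← hs])
      refine ⟨?_, by rw [hd.tor, Matrix.zero_mulVec]⟩
      rw [K_e0, ← pur_single]
      congr 1
      ext1 s
      exact act_dg_of_ne _ _ (hj' s) t
    · intro b hb
      obtain ⟨s, -, rfl⟩ := Finset.mem_image.1 hb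
      rw [act_mul]
      have := congrFun H s
      simp only [tup] at this
      rw [← this, act_inv_act]
  have h1 := hd.mulVec g (g⁻¹ * h) (Pi.single J0 1)
  rw [hmem.1, hmem.2, mul_inv_cancel_left] at h1
  rw [h1]; simp

def DD (J0 : Fin a → ι) (v : Fin a → ι → F) : Prop := ∃ g : GL ι F, tup J0 g = v

open Classical in
def Ft (d : GL ι F → Matrix (Fin a → ι) (Fin a → ι) F) (J0 : Fin a → ι) (v : Fin a → ι → F) :
    (Fin a → ι) → F :=
  if h : DD J0 v then Matrix.mulVec (d h.choose) (Pi.single J0 1) else 0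

lemma IsDer.Ft_tup (hd : IsDer d) (J0 : Fin a → ι) (g : GL ι F) :
    Ft d J0 (tup J0 g) = Matrix.mulVec (d g) (Pi.single J0 1) := by
  have h : DD J0 (tup J0 g) := ⟨g, rfl⟩
  rw [Ft, dif_pos h]
  exact hd.F_dep J0 _ _ h.choose_spec

lemma IsDer.local_lin (hd : IsDer d) (J0 : Fin a → ι) (hJ : Function.Injective J0) (g : GL ι F)
    (s : Fin a) : ∃ ℓ : (ι → F) →ₗ[F] ((Fin a → ι) → F), ∀ v, act g⁻¹ v (J0 s) ≠ 0 →
      Ft d J0 (Function.update (tup J0 g) s v) = ℓ v := by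
  obtain ⟨φ, hφ⟩ := hd.P1_lin (J0 s) J0 (cnt_one J0 hJ s)
  let L := Matrix.mulVecLin ((g⁻¹ : GL ι F) : Matrix ι ι F)
  refine ⟨(Matrix.mulVecLin (d g)).comp ((pur.toLinearMap (fun r => eb (J0 r)) s).comp L) +
    (Matrix.mulVecLin (K (g : Matrix ι ι F))).comp (φ.comp L), ?_⟩
  intro v hv
  set z := act g⁻¹ v with hz
  let h := U (J0 s) ((z (J0 s))⁻¹ • z) * dg (Function.update 1 (J0 s) (Units.mk0 (z (J0 s)) hv))
  have hh : act h (eb (J0 s)) = z := act_h_self (J0 s) z hv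
  have hfix : ∀ r, r ≠ s → act h (eb (J0 r)) = eb (J0 r) := by
    intro r hr
    have : J0 r ≠ J0 s := hJ.ne hr
    rw [act_mul, act_dg_of_ne _ _ this, act_U_of_ne _ _ this]
  have htup : tup J0 h = Function.update (fun r => eb (J0 r)) s z := by
    ext1 r
    by_cases hr : r = s
    · subst hr; simp [tup, hh]
    · simp only [tup]; rw [hfix r hr, Function.update_of_ne hr]
  have htup2 : tup J0 (g * h) = Function.update (tup J0 g) s v := by
    ext1 r
    by_cases hr : r = s
    · subst hr; simp only [tup, act_mul, hh, Function.update_self]; rw [hz, act_act_inv]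
    · rw [Function.update_of_ne hr]; simp only [tup, act_mul]; rw [hfix r hr]
  have hdh : Matrix.mulVec (d h) (Pi.single J0 1) = φ z := by
    rw [hd.mulVec, hd.tor, dg_val, K_diagonal, Matrix.zero_mulVec, Matrix.mulVec_zero, add_zero]
    have : Matrix.mulVec (Matrix.diagonal fun I : Fin a → ι =>
        ∏ r, ((Function.update (1 : ι → Fˣ) (J0 s) (Units.mk0 (z (J0 s)) hv) (I r) : Fˣ) : F))
        (Pi.single J0 1) = z (J0 s) • Pi.single J0 1 := by
      ext I
      rw [Matrix.mulVec_diagonal]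
      by_cases hI : I = J0
      · subst hI
        rw [prod_update, cnt_one I hJ s]; simp
      · simp [hI]
    rw [this, Matrix.mulVec_smul, hφ, map_smul, smul_smul, mul_inv_cancel₀ hv, one_smul]
  rw [← htup2, hd.Ft_tup, hd.mulVec, hdh, K_e0, htup]
  rfl

lemma IsDer.SL [Fintype F] (hq : 5 ≤ Fintype.card F) (hd : IsDer d) (J0 : Fin a → ι)
    (hJ : Function.Injective J0) (v : Fin a → ι → F) (s : Fin a) :
    ∃ ℓ : (ι → F) →ₗ[F] ((Fin a → ι) → F), ∀ x, DD J0 (Function.update v s x) →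
      Ft d J0 (Function.update v s x) = ℓ x := by
  by_cases hex : ∃ x, DD J0 (Function.update v s x)
  swap
  · exact ⟨0, fun x hx => absurd ⟨x, hx⟩ hex⟩
  obtain ⟨x0, g0, hg0⟩ := hex
  obtain ⟨ℓ0, h0⟩ := hd.local_lin J0 hJ g0 s
  refine ⟨ℓ0, ?_⟩
  rintro x ⟨g, hg⟩
  obtain ⟨ℓ, h1⟩ := hd.local_lin J0 hJ g s
  have hup : ∀ y, Function.update (tup J0 g) s y = Function.update v s y := by
    intro y; rw [hg]; simp
  have hup0 : ∀ y, Function.update (tup J0 g0) s y = Function.update v s y := by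
    intro y; rw [hg0]; simp
  let θ : GL ι F → (ι → F) →ₗ[F] F := fun g =>
    (LinearMap.proj (J0 s)).comp (Matrix.mulVecLin ((g⁻¹ : GL ι F) : Matrix ι ι F))
  have hθ : ∀ g, LinearMap.ker (θ g) ≠ ⊤ := by
    intro g hc
    have : act g (eb (J0 s)) ∈ LinearMap.ker (θ g) := by rw [hc]; trivial
    rw [LinearMap.mem_ker] at this
    change act g⁻¹ (act g (eb (J0 s))) (J0 s) = 0 at this
    rw [act_inv_act] at this
    simp [eb] at this
  have heq : ℓ - ℓ0 = 0 := by
    refine eq_zero_of_off hq (hθ g) (hθ g0) (hθ g) _ ?_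
    intro y hy hy0 _
    rw [LinearMap.mem_ker] at hy hy0
    rw [LinearMap.sub_apply, ← h1 y hy, ← h0 y hy0, hup, hup0, sub_self]
  have hx : act g⁻¹ x (J0 s) ≠ 0 := by
    have : x = act g (eb (J0 s)) := by
      have := congrFun hg s
      simpa [tup] using this.symm
    rw [this, act_inv_act]; simp [eb]
  rw [← hup, h1 x hx, sub_eq_zero.1 heq]

lemma multi_w (f : MultilinearMap F (fun _ : Fin a => ι → F) ((Fin a → ι) → F)) :
    ∃ w : Matrix (Fin a → ι) (Fin a → ι) F, ∀ v, f v = Matrix.mulVec w (pur v) := by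
  refine ⟨Matrix.of fun I J => f (fun s => eb (J s)) I, ?_⟩
  set w : Matrix (Fin a → ι) (Fin a → ι) F := Matrix.of fun I J => f (fun s => eb (J s)) I
  have : f = (Matrix.mulVecLin w).compMultilinearMap pur := by
    refine Module.Basis.ext_multilinear (fun _ => Pi.basisFun F ι) ?_
    intro J
    simp only [Pi.basisFun_apply, LinearMap.compMultilinearMap_apply, Matrix.mulVecLin_apply]
    rw [pur_single]
    ext I
    simp [w]
  intro v
  conv_lhs => rw [this]
  rfl

lemma IsDer.main_of (hd : IsDer d) (J0 : Fin a → ι)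
    (hext : ∃ w : Matrix (Fin a → ι) (Fin a → ι) F,
      ∀ g : GL ι F, Matrix.mulVec (d g) (Pi.single J0 1) = Matrix.mulVec w (pur (tup J0 g)))
    (hspan : ∀ x : Matrix (Fin a → ι) (Fin a → ι) F,
      (∀ g : GL ι F, Matrix.mulVec x (pur (tup J0 g)) = 0) → x = 0) :
    ∃ w : Matrix (Fin a → ι) (Fin a → ι) F, ∀ g : GL ι F,
      d g = w * K (g : Matrix ι ι F) - K (g : Matrix ι ι F) * w := by
  obtain ⟨w, hw⟩ := hext
  refine ⟨w, fun g => ?_⟩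
  rw [← sub_eq_zero]
  apply hspan
  intro h
  have h1 := hd.mulVec g h (Pi.single J0 1)
  rw [hw, hw, K_e0, ← K_tup] at h1
  rw [Matrix.sub_mulVec, Matrix.sub_mulVec, ← Matrix.mulVec_mulVec, ← Matrix.mulVec_mulVec, h1]
  abel

end Gens

set_option linter.unusedSectionVars false
set_option linter.unusedSimpArgs false
section MainA

variable {F : Type} [Field F] [Fintype F] {ι : Type} [Fintype ι] [DecidableEq ι]

lemma exists_ne_of_not_span1 (z : ι → F) (j : ι) (h : z ∉ (F ∙ (eb j : ι → F))) :
    ∃ i, i ≠ j ∧ z i ≠ 0 := by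
  by_contra hc
  push Not at hc
  apply h
  rw [Submodule.mem_span_singleton]
  refine ⟨z j, ?_⟩
  ext i
  by_cases hi : i = j
  · subst hi; simp
  · simp [hi, hc i hi]

lemma exists_ne_of_not_span2 (z : ι → F) (j l : ι) (hjl : j ≠ l)
    (h : z ∉ (F ∙ (eb j : ι → F)) ⊔ (F ∙ (eb l : ι → F))) :
    ∃ i, i ≠ j ∧ i ≠ l ∧ z i ≠ 0 := by
  by_contra hc
  push Not at hc
  apply h
  rw [Submodule.mem_sup]
  refine ⟨z j • eb j, Submodule.smul_mem _ _ (Submodule.mem_span_singleton_self _),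
    z l • eb l, Submodule.smul_mem _ _ (Submodule.mem_span_singleton_self _), ?_⟩
  ext i
  by_cases hi : i = j
  · subst hi; simp [hjl]
  · by_cases hl : i = l
    · subst hl; simp [hi]
    · simp [hi, hl, hc i hi hl]

lemma act_smul (g : GL ι F) (c : F) (v : ι → F) : act g (c • v) = c • act g v :=
  Matrix.mulVec_smul _ _ _

lemma act_add (g : GL ι F) (u v : ι → F) : act g (u + v) = act g u + act g v :=
  Matrix.mulVec_add _ _ _

lemma mem_span1_act (g : GL ι F) (u v : ι → F) (h : act g u ∈ (F ∙ act g v)) : u ∈ (F ∙ v) := by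
  obtain ⟨c, hc⟩ := Submodule.mem_span_singleton.1 h
  refine Submodule.mem_span_singleton.2 ⟨c, ?_⟩
  rw [← act_smul] at hc
  have := congrArg (act g⁻¹) hc
  rwa [act_inv_act, act_inv_act] at this

lemma mem_span2_act (g : GL ι F) (u v w : ι → F) (h : act g u ∈ (F ∙ act g v) ⊔ (F ∙ act g w)) :
    u ∈ (F ∙ v) ⊔ (F ∙ w) := by
  obtain ⟨x, hx, y, hy, hxy⟩ := Submodule.mem_sup.1 h
  obtain ⟨c, rfl⟩ := Submodule.mem_span_singleton.1 hx
  obtain ⟨e, rfl⟩ := Submodule.mem_span_singleton.1 hy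
  rw [← act_smul, ← act_smul, ← act_add] at hxy
  have := congrArg (act g⁻¹) hxy
  rw [act_inv_act, act_inv_act] at this
  rw [← this]
  exact Submodule.add_mem_sup (Submodule.smul_mem _ _ (Submodule.mem_span_singleton_self _))
    (Submodule.smul_mem _ _ (Submodule.mem_span_singleton_self _))

lemma ind_DD (J0 : Fin 3 → ι) (hJ : Function.Injective J0) (v1 v2 v3 : ι → F)
    (h : Ind (F := F) v1 v2 v3) : DD J0 ![v1, v2, v3] := by
  obtain ⟨h3, h2, h1⟩ := h
  have n01 : J0 0 ≠ J0 1 := hJ.ne (by decide)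
  have n02 : J0 0 ≠ J0 2 := hJ.ne (by decide)
  have n12 : J0 1 ≠ J0 2 := hJ.ne (by decide)
  obtain ⟨i, hi⟩ := Function.ne_iff.1 h3
  obtain ⟨g3, -, -, e3⟩ := lemX (⊤ : Subgroup (GL ι F)) ∅ (fun _ _ _ => trivial)
    (fun _ _ _ => trivial) v3 i (J0 2) (by simp) (by simp) hi
  obtain ⟨i, hi, hi'⟩ := exists_ne_of_not_span1 (act g3⁻¹ v2) (J0 2) (by
    intro hc
    apply h2
    have := mem_span1_act g3⁻¹ v2 v3 (by rw [← e3, act_inv_act]; exact hc)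
    exact this)
  obtain ⟨g2, -, f2, e2⟩ := lemX (⊤ : Subgroup (GL ι F)) {J0 2} (fun _ _ _ => trivial)
    (fun _ _ _ => trivial) (act g3⁻¹ v2) i (J0 1) (by simpa using hi) (by simpa using n12) hi'
  have k3 : act (g3 * g2) (eb (J0 2)) = v3 := by rw [act_mul, f2 _ (by simp), e3]
  have k2 : act (g3 * g2) (eb (J0 1)) = v2 := by rw [act_mul, e2, act_act_inv]
  obtain ⟨i, hi, hi2, hi'⟩ := exists_ne_of_not_span2 (act (g3 * g2)⁻¹ v1) (J0 2) (J0 1) n12.symm (by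
    intro hc
    apply h1
    refine mem_span2_act (g3 * g2)⁻¹ v1 v3 v2 ?_
    rw [← k3, act_inv_act, ← k2, act_inv_act]
    exact hc)
  obtain ⟨g1, -, f1, e1⟩ := lemX (⊤ : Subgroup (GL ι F)) {J0 2, J0 1} (fun _ _ _ => trivial)
    (fun _ _ _ => trivial) (act (g3 * g2)⁻¹ v1) i (J0 0) (by simp [hi, hi2]) (by simp [n01, n02]) hi'
  refine ⟨g3 * g2 * g1, ?_⟩
  ext1 s
  fin_cases s
  · change act (g3 * g2 * g1) (eb (J0 0)) = v1
    rw [act_mul, e1, act_act_inv]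
  · change act (g3 * g2 * g1) (eb (J0 1)) = v2
    rw [act_mul, f1 _ (by simp), k2]
  · change act (g3 * g2 * g1) (eb (J0 2)) = v3
    rw [act_mul, f1 _ (by simp), k3]

lemma tup_ind (J0 : Fin 3 → ι) (hJ : Function.Injective J0) (g : GL ι F) :
    Ind (F := F) (tup J0 g 0) (tup J0 g 1) (tup J0 g 2) := by
  have n01 : J0 0 ≠ J0 1 := hJ.ne (by decide)
  have n02 : J0 0 ≠ J0 2 := hJ.ne (by decide)
  have n12 : J0 1 ≠ J0 2 := hJ.ne (by decide)
  refine ⟨?_, ?_, ?_⟩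
  · intro h
    have := congrArg (act g⁻¹) h
    simp only [tup] at this
    rw [act_inv_act] at this
    have := congrFun this (J0 2)
    simp [eb] at this
  · intro h
    have := mem_span1_act g _ _ h
    obtain ⟨c, hc⟩ := Submodule.mem_span_singleton.1 this
    have := congrFun hc (J0 1)
    simp [eb, n12] at this
  · intro h
    have := mem_span2_act g _ _ _ h
    obtain ⟨x, hx, y, hy, hxy⟩ := Submodule.mem_sup.1 this
    obtain ⟨c, rfl⟩ := Submodule.mem_span_singleton.1 hx
    obtain ⟨e, rfl⟩ := Submodule.mem_span_singleton.1 hy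
    have := congrFun hxy (J0 0)
    simp [eb, n01, n02] at this

lemma span2_ne_top (hn : 3 ≤ Fintype.card ι) (u v : ι → F) : (F ∙ u) ⊔ (F ∙ v) ≠ ⊤ := by
  intro h
  have h1 := Submodule.finrank_add_le_finrank_add_finrank (F ∙ u) (F ∙ v)
  rw [h, finrank_top, Module.finrank_fintype_fun_eq_card] at h1
  have h2 := finrank_span_le_card (R := F) ({u} : Set (ι → F))
  have h3 := finrank_span_le_card (R := F) ({v} : Set (ι → F))
  simp only [Set.toFinset_singleton, Finset.card_singleton] at h2 h3
  omega

variable {Y : Type} [AddCommGroup Y] [Module F Y] {W : Type} [AddCommGroup W] [Module F W]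

def triToMulti (Φ : W →ₗ[F] W →ₗ[F] W →ₗ[F] Y) : MultilinearMap F (fun _ : Fin 3 => W) Y :=
  MultilinearMap.mk' (fun v => Φ (v 2) (v 1) (v 0))
    (by intro v s x y; fin_cases s <;> simp [Function.update])
    (by intro v s c x; fin_cases s <;> simp [Function.update])

lemma upd0 (x y z t : W) : Function.update ![x, y, z] 0 t = ![t, y, z] := by
  ext1 s; fin_cases s <;> simp [Function.update]
lemma upd1 (x y z t : W) : Function.update ![x, y, z] 1 t = ![x, t, z] := by
  ext1 s; fin_cases s <;> simp [Function.update]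
lemma upd2 (x y z t : W) : Function.update ![x, y, z] 2 t = ![x, y, t] := by
  ext1 s; fin_cases s <;> simp [Function.update]

def multiToTri (f : MultilinearMap F (fun _ : Fin 3 => W) Y) : W →ₗ[F] W →ₗ[F] W →ₗ[F] Y where
  toFun v3 := LinearMap.mk₂ F (fun v2 v1 => f ![v1, v2, v3])
    (fun x y v1 => by have := f.map_update_add ![v1, 0, v3] 1 x y; simpa only [upd1] using this)
    (fun c x v1 => by have := f.map_update_smul ![v1, 0, v3] 1 c x; simpa only [upd1] using this)
    (fun v2 x y => by have := f.map_update_add ![0, v2, v3] 0 x y; simpa only [upd0] using this)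
    (fun c v2 x => by have := f.map_update_smul ![0, v2, v3] 0 c x; simpa only [upd0] using this)
  map_add' x y := by
    refine LinearMap.ext₂ fun v2 v1 => ?_
    have := f.map_update_add ![v1, v2, 0] 2 x y
    simp only [upd2] at this
    exact this
  map_smul' c x := by
    refine LinearMap.ext₂ fun v2 v1 => ?_
    have := f.map_update_smul ![v1, v2, 0] 2 c x
    simp only [upd2] at this
    exact this

lemma span3 (hq : 5 ≤ Fintype.card F) (hn : 3 ≤ Fintype.card ι) (J0 : Fin 3 → ι)
    (hJ : Function.Injective J0) (x : Matrix (Fin 3 → ι) (Fin 3 → ι) F)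
    (h : ∀ g : GL ι F, Matrix.mulVec x (pur (tup J0 g)) = 0) : x = 0 := by
  have h0 : multiToTri ((Matrix.mulVecLin x).compMultilinearMap (pur (a := 3) (ι := ι))) = 0 := by
    refine trilin_zero hq (span2_ne_top hn) _ ?_
    intro v1 v2 v3 hi
    obtain ⟨g, hg⟩ := ind_DD J0 hJ v1 v2 v3 hi
    change Matrix.mulVec x (pur ![v1, v2, v3]) = 0
    rw [← hg]; exact h g
  ext I J
  have h1 : multiToTri ((Matrix.mulVecLin x).compMultilinearMap (pur (a := 3) (ι := ι)))
    (eb (J 2)) (eb (J 1)) (eb (J 0)) I = 0 := by rw [h0]; rfl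
  change Matrix.mulVec x (pur ![eb (J 0), eb (J 1), eb (J 2)]) I = 0 at h1
  have h2 : ![eb (J 0), eb (J 1), eb (J 2)] = fun s => (Pi.single (J s) 1 : ι → F) := by
    ext1 s; fin_cases s <;> rfl
  rw [h2, pur_single] at h1
  simpa using h1

theorem main3 (hq : 5 ≤ Fintype.card F) (hn : 3 ≤ Fintype.card ι)
    {d : GL ι F → Matrix (Fin 3 → ι) (Fin 3 → ι) F} (hd : IsDer d) :
    ∃ w : Matrix (Fin 3 → ι) (Fin 3 → ι) F, ∀ g : GL ι F,
      d g = w * K (g : Matrix ι ι F) - K (g : Matrix ι ι F) * w := by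
  obtain ⟨J0⟩ : Nonempty (Fin 3 ↪ ι) := Function.Embedding.nonempty_of_card_le (by simpa using hn)
  refine hd.main_of J0 ?_ (span3 hq hn J0 J0.injective)
  have hup0 : ∀ v2 v3 : ι → F, ∃ ℓ : (ι → F) →ₗ[F] _, ∀ v1, Ind (F := F) v1 v2 v3 →
      Ft d J0 ![v1, v2, v3] = ℓ v1 := by
    intro v2 v3
    obtain ⟨ℓ, hℓ⟩ := hd.SL hq J0 J0.injective ![0, v2, v3] 0
    refine ⟨ℓ, fun v1 hi => ?_⟩
    have := hℓ v1
    rw [upd0] at this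
    exact this (ind_DD J0 J0.injective _ _ _ hi)
  have hup1 : ∀ v1 v3 : ι → F, ∃ ℓ : (ι → F) →ₗ[F] _, ∀ v2, Ind (F := F) v1 v2 v3 →
      Ft d J0 ![v1, v2, v3] = ℓ v2 := by
    intro v1 v3
    obtain ⟨ℓ, hℓ⟩ := hd.SL hq J0 J0.injective ![v1, 0, v3] 1
    refine ⟨ℓ, fun v2 hi => ?_⟩
    have := hℓ v2
    rw [upd1] at this
    exact this (ind_DD J0 J0.injective _ _ _ hi)
  have hup2 : ∀ v1 v2 : ι → F, ∃ ℓ : (ι → F) →ₗ[F] _, ∀ v3, Ind (F := F) v1 v2 v3 →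
      Ft d J0 ![v1, v2, v3] = ℓ v3 := by
    intro v1 v2
    obtain ⟨ℓ, hℓ⟩ := hd.SL hq J0 J0.injective ![v1, v2, 0] 2
    refine ⟨ℓ, fun v3 hi => ?_⟩
    have := hℓ v3
    rw [upd2] at this
    exact this (ind_DD J0 J0.injective _ _ _ hi)
  obtain ⟨Φ, hΦ⟩ := trilin_ext hq hd.two (span2_ne_top hn)
    (fun v1 v2 v3 : ι → F => Ft d J0 ![v1, v2, v3]) hup0 hup1 hup2
  obtain ⟨w, hw⟩ := multi_w (triToMulti Φ)
  refine ⟨w, fun g => ?_⟩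
  rw [← hw, ← hd.Ft_tup]
  have h1 := hΦ _ _ _ (tup_ind J0 J0.injective g)
  have h2 : ![tup J0 g 0, tup J0 g 1, tup J0 g 2] = tup J0 g := by
    ext1 s; fin_cases s <;> rfl
  simp only [h2] at h1
  rw [h1]; rfl

theorem main1 (hq : 5 ≤ Fintype.card F) (i0 : ι)
    {d : GL ι F → Matrix (Fin 1 → ι) (Fin 1 → ι) F} (hd : IsDer d) :
    ∃ w : Matrix (Fin 1 → ι) (Fin 1 → ι) F, ∀ g : GL ι F,
      d g = w * K (g : Matrix ι ι F) - K (g : Matrix ι ι F) * w := by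
  have hJ : Function.Injective (fun _ : Fin 1 => i0) := fun _ _ _ => Subsingleton.elim _ _
  refine hd.main_of (fun _ => i0) ?_ ?_
  · obtain ⟨ℓ, hℓ⟩ := hd.SL hq (fun _ => i0) hJ 0 0
    obtain ⟨w, hw⟩ := multi_w (ι := ι) (a := 1) (MultilinearMap.mk' (fun v => ℓ (v 0))
      (by intro v s x y; fin_cases s; simp)
      (by intro v s c x; fin_cases s; simp))
    refine ⟨w, fun g => ?_⟩
    rw [← hw, ← hd.Ft_tup]
    have h2 : Function.update (0 : Fin 1 → ι → F) 0 (tup (fun _ : Fin 1 => i0) g 0) = tup (fun _ : Fin 1 => i0) g := by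
      ext1 s; fin_cases s; simp
    have := hℓ (tup (fun _ : Fin 1 => i0) g 0)
    rw [h2] at this
    exact this ⟨g, rfl⟩
  · intro x hx
    ext I J
    obtain ⟨h, -, -, he⟩ := lemX (⊤ : Subgroup (GL ι F)) ∅ (fun _ _ _ => trivial)
      (fun _ _ _ => trivial) (eb (J 0)) (J 0) i0 (by simp) (by simp) (by simp [eb])
    have h1 := congrFun (hx h) I
    have h2 : tup (fun _ : Fin 1 => i0) h = fun s => (Pi.single (J s) 1 : ι → F) := by
      ext1 s; fin_cases s; exact he
    rw [h2, pur_single] at h1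
    simpa using h1

end MainA

set_option linter.unusedSectionVars false
set_option linter.unusedSimpArgs false
section Models

variable {F : Type} [Field F] [Fintype F] {ι : Type} [Fintype ι] [DecidableEq ι]

lemma card_torus_ne [DecidableEq F] : ((Fintype.card (ι → Fˣ) : ℕ) : F) ≠ 0 := by
  have h1 : Fintype.card F = Fintype.card Fˣ + 1 := Fintype.card_eq_card_units_add_one F
  have h2 : ((Fintype.card Fˣ : ℕ) : F) = -1 := by
    have := congrArg (Nat.cast : ℕ → F) h1
    rw [FiniteField.cast_card_eq_zero] at this
    push_cast at this
    exact eq_neg_of_add_eq_zero_left this.symm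
  rw [Fintype.card_fun, Nat.cast_pow, h2]
  exact pow_ne_zero _ (by simp)

lemma normalise {M : Type} [AddCommGroup M] [Module F M] (ρ : Representation F (GL ι F) M)
    (c : GL ι F → M) (hc : ∀ g h, c (g * h) = ρ g (c h) + c g) :
    ∃ m, ∀ t, c (dg t) = ρ (dg t) m - m := by
  classical
  let σ := ∑ t : ι → Fˣ, c (dg t)
  have key : ∀ u, σ = ρ (dg u) σ + (Fintype.card (ι → Fˣ) : F) • c (dg u) := by
    intro u
    have : σ = ∑ t, c (dg (u * t)) := (Equiv.sum_comp (Equiv.mulLeft u) fun t => c (dg t)).symm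
    conv_lhs => rw [this]
    simp only [← dg_mul, hc, Finset.sum_add_distrib]
    rw [Finset.sum_const, Finset.card_univ, ← map_sum, Nat.cast_smul_eq_nsmul]
  refine ⟨-((Fintype.card (ι → Fˣ) : F)⁻¹ • σ), fun u => ?_⟩
  have h := key u
  have h2 : (Fintype.card (ι → Fˣ) : F) • c (dg u) = σ - ρ (dg u) σ := by
    conv_rhs => enter [1]; rw [h]
    abel
  have h3 := congrArg (fun x => (Fintype.card (ι → Fˣ) : F)⁻¹ • x) h2
  simp only [smul_smul] at h3
  rw [inv_mul_cancel₀ card_torus_ne, one_smul] at h3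
  rw [h3, map_neg, map_smul, smul_sub]
  abel

lemma h1_generic {a : ℕ} (ha : a ≤ 3) {M : Type} [AddCommGroup M] [Module F M]
    (ρ : Representation F (GL ι F) M)
    (Q : M →ₗ[F] Matrix (Fin a → ι) (Fin a → ι) F) (R : Matrix (Fin a → ι) (Fin a → ι) F →ₗ[F] M)
    (hRQ : ∀ m, R (Q m) = m)
    (hQ : ∀ g m, Q (ρ g m) * K (g : Matrix ι ι F) = K (g : Matrix ι ι F) * Q m)
    (hR : ∀ (g : GL ι F) x, R (K (g : Matrix ι ι F) * x * K ((g⁻¹ : GL ι F) : Matrix ι ι F)) = ρ g (R x))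
    (htop : a = 3 → ∀ m i j, i ≠ j → Q m (fun _ => j) (fun _ => i) = 0)
    (h2 : (2 : F) ≠ 0) (h3 : (3 : F) ≠ 0) (h7 : (7 : F) ≠ 0 ∨ (26 : F) ≠ 0)
    (hmain : ∀ d : GL ι F → Matrix (Fin a → ι) (Fin a → ι) F, IsDer d → ∃ w, ∀ g : GL ι F,
      d g = w * K (g : Matrix ι ι F) - K (g : Matrix ι ι F) * w)
    (c : GL ι F → M) (hc : ∀ g h, c (g * h) = ρ g (c h) + c g) :
    ∃ m, ∀ g, c g = ρ g m - m := by
  obtain ⟨m0, hm0⟩ := normalise ρ c hc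
  let c' : GL ι F → M := fun g => c g - (ρ g m0 - m0)
  have hc' : ∀ g h, c' (g * h) = ρ g (c' h) + c' g := by
    intro g h
    simp only [c', hc, map_mul, Module.End.mul_apply, map_sub]
    abel
  have hder : IsDer (fun g => Q (c' g) * K (g : Matrix ι ι F)) := by
    refine ⟨?_, ?_, ?_, h2, h3, h7, ha⟩
    · intro g h
      simp only [hc', map_add, Units.val_mul, K_mul, add_mul]
      rw [← Matrix.mul_assoc, hQ, Matrix.mul_assoc, ← Matrix.mul_assoc (Q (c' g)), add_comm]
    · intro t
      simp only [c', hm0, sub_self, map_zero, Matrix.zero_mul]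
    · intro ha3 i j hij x
      simp only [Matrix.mul_apply]
      apply Finset.sum_eq_zero
      intro L _
      by_cases hL : L = fun _ => i
      · rw [hL, htop ha3 _ i j hij, zero_mul]
      · by_cases hK : K (U j (Pi.single i x) : Matrix ι ι F) L (fun _ => i) = 0
        · rw [hK, mul_zero]
        · have := K_U_lt _ _ _ _ hK hL
          rw [cnt_zero (fun _ : Fin a => i) j (fun _ => hij)] at this
          omega
  obtain ⟨w, hw⟩ := hmain _ hder
  refine ⟨m0 - R w, fun g => ?_⟩
  have h1 : Q (c' g) = w - K (g : Matrix ι ι F) * w * K ((g⁻¹ : GL ι F) : Matrix ι ι F) := by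
    have hKK : (K (g : Matrix ι ι F) * K ((g⁻¹ : GL ι F) : Matrix ι ι F) :
        Matrix (Fin a → ι) (Fin a → ι) F) = 1 := by
      rw [← K_mul, ← Units.val_mul, mul_inv_cancel, Units.val_one, K_one]
    have := congrArg (fun x => x * K ((g⁻¹ : GL ι F) : Matrix ι ι F)) (hw g)
    simp only [sub_mul] at this
    rw [Matrix.mul_assoc, Matrix.mul_assoc w, hKK, Matrix.mul_one, Matrix.mul_one] at this
    exact this
  have h2 := congrArg R h1
  rw [hRQ, map_sub, hR] at h2
  have h3 : c g = c' g + (ρ g m0 - m0) := by simp [c']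
  rw [h3, h2, map_sub]
  abel

def outer {a : ℕ} : MultilinearMap F (fun _ : Fin a => Matrix ι ι F) (Matrix (Fin a → ι) (Fin a → ι) F) :=
  (Matrix.ofLinearEquiv F).toLinearMap.compMultilinearMap <| MultilinearMap.pi fun I => MultilinearMap.pi fun J =>
    (MultilinearMap.mkPiAlgebra F (Fin a) F).compLinearMap
      fun s => Matrix.entryLinearMap F F (I s) (J s)

lemma outer_apply {a : ℕ} (A : Fin a → Matrix ι ι F) (I J : Fin a → ι) :
    outer A I J = ∏ s, A s (I s) (J s) := by
  simp [outer]

lemma outer_mul {a : ℕ} (A B : Fin a → Matrix ι ι F) :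
    outer (fun s => A s * B s) = outer A * outer B := by
  ext I J
  simp only [outer_apply, Matrix.mul_apply]
  rw [Finset.prod_univ_sum, Fintype.piFinset_univ]
  simp [Finset.prod_mul_distrib]

lemma outer_conj {a : ℕ} (g h : Matrix ι ι F) (A : Fin a → Matrix ι ι F) :
    outer (fun s => g * A s * h) = K g * outer A * K h := by
  rw [outer_mul (fun s => g * A s) (fun _ => h), outer_mul (fun _ => g) A]
  congr 1

lemma outer_single {a : ℕ} (I J : Fin a → ι) :
    outer (fun s => Matrix.single (I s) (J s) (1 : F)) = Matrix.single I J 1 := by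
  ext I' J'
  rw [outer_apply]
  by_cases h : I = I' ∧ J = J'
  · obtain ⟨rfl, rfl⟩ := h; simp
  · rw [Matrix.single_apply, if_neg h]
    have : ∃ s, ¬ (I s = I' s ∧ J s = J' s) := by
      by_contra hc
      push Not at hc
      exact h ⟨funext fun s => (hc s).1, funext fun s => (hc s).2⟩
    obtain ⟨s, hs⟩ := this
    exact Finset.prod_eq_zero (Finset.mem_univ s) (by rw [Matrix.single_apply, if_neg hs])

lemma ext_outer {a : ℕ} {M : Type} [AddCommGroup M] [Module F M]
    {f f' : Matrix (Fin a → ι) (Fin a → ι) F →ₗ[F] M} (h : ∀ A, f (outer A) = f' (outer A)) :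
    f = f' := by
  refine Module.Basis.ext (Matrix.stdBasis F (Fin a → ι) (Fin a → ι)) ?_
  rintro ⟨I, J⟩
  rw [Matrix.stdBasis_eq_single, ← outer_single]
  exact h _

section Alt

variable {V : Type} [AddCommGroup V] [Module F V]

def mkA (F : Type) [Field F] (V : Type) [AddCommGroup V] [Module F V] : V [⋀^Fin 3]→ₗ[F] AltPow F V 3 :=
  { ((altPowSub F V 3).mkQ).compMultilinearMap (PiTensorProduct.tprod F) with
    map_eq_zero_of_eq' := by
      intro v i j hv hij
      refine (Submodule.Quotient.mk_eq_zero _).2 ?_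
      exact Submodule.subset_span ⟨v, i, j, hij, hv, rfl⟩ }

lemma mkA_apply (v : Fin 3 → V) : mkA F V v = Submodule.Quotient.mk (PiTensorProduct.tprod F v) := rfl

def liftA {Z : Type} [AddCommGroup Z] [Module F Z] (f : V [⋀^Fin 3]→ₗ[F] Z) : AltPow F V 3 →ₗ[F] Z :=
  (altPowSub F V 3).liftQ (PiTensorProduct.lift f.toMultilinearMap) (by
    rw [altPowSub, Submodule.span_le]
    rintro z ⟨v, i, j, hij, hv, rfl⟩
    simp only [SetLike.mem_coe, LinearMap.mem_ker, PiTensorProduct.lift.tprod]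
    exact f.map_eq_zero_of_eq v hv hij)

lemma liftA_mkA {Z : Type} [AddCommGroup Z] [Module F Z] (f : V [⋀^Fin 3]→ₗ[F] Z) (v : Fin 3 → V) :
    liftA f (mkA F V v) = f v := by
  rw [mkA_apply, liftA]
  erw [Submodule.liftQ_apply]
  simp

lemma extA {Z : Type} [AddCommGroup Z] [Module F Z] {f f' : AltPow F V 3 →ₗ[F] Z}
    (h : ∀ v, f (mkA F V v) = f' (mkA F V v)) : f = f' := by
  refine Submodule.linearMap_qext _ (PiTensorProduct.ext ?_)
  ext v
  exact h v

lemma altPowRep_mkA {G : Type} [Group G] (ρ : Representation F G V) (g : G) (v : Fin 3 → V) :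
    altPowRep F V 3 ρ g (mkA F V v) = mkA F V fun s => ρ g (v s) := by
  rw [mkA_apply, mkA_apply, ← tpowRep_apply]
  rfl

lemma altern_apply {Z : Type} [AddCommGroup Z] [Module F Z]
    (f : MultilinearMap F (fun _ : Fin 3 => V) Z) (v : Fin 3 → V) :
    MultilinearMap.alternatization f v =
      ∑ σ : Equiv.Perm (Fin 3), (Equiv.Perm.sign σ : ℤˣ) • f (v ∘ σ) := by
  rw [MultilinearMap.alternatization_apply]
  rfl

end Alt

def Q3 : AltPow F (Matrix ι ι F) 3 →ₗ[F] Matrix (Fin 3 → ι) (Fin 3 → ι) F :=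
  liftA (MultilinearMap.alternatization outer)

lemma Q3_mkA (A : Fin 3 → Matrix ι ι F) :
    Q3 (mkA F (Matrix ι ι F) A) = ∑ σ : Equiv.Perm (Fin 3), (Equiv.Perm.sign σ : ℤˣ) • outer (A ∘ σ) := by
  rw [Q3, liftA_mkA, altern_apply]

def R3 : Matrix (Fin 3 → ι) (Fin 3 → ι) F →ₗ[F] AltPow F (Matrix ι ι F) 3 :=
  (6 : F)⁻¹ • (Matrix.stdBasis F (Fin 3 → ι) (Fin 3 → ι)).constr F
    fun IJ => mkA F (Matrix ι ι F) fun s => Matrix.single (IJ.1 s) (IJ.2 s) 1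

lemma R3_outer (A : Fin 3 → Matrix ι ι F) : R3 (outer A) = (6 : F)⁻¹ • mkA F (Matrix ι ι F) A := by
  rw [R3, LinearMap.smul_apply]
  congr 1
  have : ((Matrix.stdBasis F (Fin 3 → ι) (Fin 3 → ι)).constr F
    fun IJ => mkA F (Matrix ι ι F) fun s => Matrix.single (IJ.1 s) (IJ.2 s) 1).compMultilinearMap outer
      = (mkA F (Matrix ι ι F)).toMultilinearMap := by
    refine Module.Basis.ext_multilinear (fun _ => Matrix.stdBasis F ι ι) ?_
    intro v
    have hv : (fun s => Matrix.stdBasis F ι ι (v s)) =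
        fun s => Matrix.single (v s).1 (v s).2 (1 : F) := by
      ext1 s; exact Matrix.stdBasis_eq_single _ _ _
    rw [hv, LinearMap.compMultilinearMap_apply, outer_single (fun s => (v s).1) (fun s => (v s).2),
      ← Matrix.stdBasis_eq_single, Module.Basis.constr_basis]
    rfl
  exact DFunLike.congr_fun this A

lemma R3_Q3 (h2 : (2 : F) ≠ 0) (h3 : (3 : F) ≠ 0) (m : AltPow F (Matrix ι ι F) 3) : R3 (Q3 m) = m := by
  have : R3.comp (Q3 (F := F) (ι := ι)) = LinearMap.id := by
    refine extA fun A => ?_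
    rw [LinearMap.comp_apply, Q3_mkA, map_sum]
    simp only [LinearMap.map_smul_of_tower, R3_outer]
    have : ∀ σ : Equiv.Perm (Fin 3), (Equiv.Perm.sign σ : ℤˣ) • (6 : F)⁻¹ • mkA F (Matrix ι ι F) (A ∘ σ) =
        (6 : F)⁻¹ • mkA F (Matrix ι ι F) A := by
      intro σ
      rw [AlternatingMap.map_perm, smul_comm, smul_smul, Int.units_mul_self, one_smul]
    simp only [this, Finset.sum_const, Finset.card_univ, Fintype.card_perm, Fintype.card_fin]
    rw [← Nat.cast_smul_eq_nsmul F, smul_smul]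
    have h6 : (6 : F) ≠ 0 := by
      rw [show (6 : F) = 2 * 3 by norm_num]; exact mul_ne_zero h2 h3
    simp [Nat.factorial, h6]
  exact LinearMap.congr_fun this m

end Models

section Models2

variable {F : Type} [Field F] [Fintype F] {n : ℕ}

lemma glConj_apply (g : GL (Fin n) F) (x : Matrix (Fin n) (Fin n) F) :
    glConj F n g x = (g : Matrix (Fin n) (Fin n) F) * x * ((g⁻¹ : GL (Fin n) F) : Matrix (Fin n) (Fin n) F) := rfl

lemma K_inv_mul {ι : Type} [Fintype ι] [DecidableEq ι] {a : ℕ} (g : GL ι F) :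
    (K ((g⁻¹ : GL ι F) : Matrix ι ι F) * K (g : Matrix ι ι F) : Matrix (Fin a → ι) (Fin a → ι) F) = 1 := by
  rw [← K_mul, ← Units.val_mul, inv_mul_cancel, Units.val_one, K_one]

lemma Q3_equiv' (g : GL (Fin n) F) (m) :
    Q3 (altPowRep F _ 3 (glConj F n) g m) =
      K (g : Matrix (Fin n) (Fin n) F) * Q3 m * K ((g⁻¹ : GL (Fin n) F) : Matrix (Fin n) (Fin n) F) := by
  have : Q3.comp (altPowRep F _ 3 (glConj F n) g) =
      ((LinearMap.mulRight F (K ((g⁻¹ : GL (Fin n) F) : Matrix (Fin n) (Fin n) F))).comp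
        (LinearMap.mulLeft F (K (g : Matrix (Fin n) (Fin n) F)))).comp Q3 := by
    refine extA fun A => ?_
    simp only [LinearMap.comp_apply, altPowRep_mkA, Q3_mkA, LinearMap.mulRight_apply, LinearMap.mulLeft_apply]
    rw [Finset.mul_sum, Finset.sum_mul]
    refine Finset.sum_congr rfl fun σ _ => ?_
    rw [mul_smul_comm, smul_mul_assoc, ← outer_conj]
    rfl
  exact LinearMap.congr_fun this m

lemma Q3_equiv (g : GL (Fin n) F) (m) :
    Q3 (altPowRep F _ 3 (glConj F n) g m) * K (g : Matrix (Fin n) (Fin n) F) =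
      K (g : Matrix (Fin n) (Fin n) F) * Q3 m := by
  rw [Q3_equiv', Matrix.mul_assoc, K_inv_mul, Matrix.mul_one]

lemma R3_equiv (g : GL (Fin n) F) (x) :
    R3 (K (g : Matrix (Fin n) (Fin n) F) * x * K ((g⁻¹ : GL (Fin n) F) : Matrix (Fin n) (Fin n) F)) =
      altPowRep F _ 3 (glConj F n) g (R3 x) := by
  have : R3.comp ((LinearMap.mulRight F (K ((g⁻¹ : GL (Fin n) F) : Matrix (Fin n) (Fin n) F))).comp
        (LinearMap.mulLeft F (K (g : Matrix (Fin n) (Fin n) F)))) =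
        (altPowRep F _ 3 (glConj F n) g).comp R3 := by
    refine ext_outer fun A => ?_
    simp only [LinearMap.comp_apply, LinearMap.mulRight_apply, LinearMap.mulLeft_apply]
    rw [← outer_conj, R3_outer, R3_outer, map_smul, altPowRep_mkA]
    rfl
  exact LinearMap.congr_fun this x

lemma Q3_perm {ι : Type} [Fintype ι] [DecidableEq ι] (m : AltPow F (Matrix ι ι F) 3)
    (τ : Equiv.Perm (Fin 3)) (I J : Fin 3 → ι) :
    Q3 m (I ∘ τ) (J ∘ τ) = (Equiv.Perm.sign τ : ℤˣ) • Q3 m I J := by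
  have : (Matrix.entryLinearMap F F (I ∘ τ) (J ∘ τ)).comp (Q3 (F := F) (ι := ι)) =
      (Equiv.Perm.sign τ : ℤˣ) • (Matrix.entryLinearMap F F I J).comp Q3 := by
    refine extA fun A => ?_
    simp only [LinearMap.comp_apply, LinearMap.smul_apply, Q3_mkA, Matrix.entryLinearMap_apply,
      Matrix.sum_apply, Matrix.smul_apply, outer_apply]
    rw [← Equiv.sum_comp (Equiv.mulRight τ), Finset.smul_sum]
    refine Finset.sum_congr rfl fun σ _ => ?_
    simp only [Equiv.coe_mulRight, map_mul, smul_smul]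
    rw [mul_comm]
    congr 1
    exact Equiv.prod_comp τ fun s => (A ∘ σ) s (I s) (J s)
  exact LinearMap.congr_fun this m

lemma Q3_top {ι : Type} [Fintype ι] [DecidableEq ι] (h2 : (2 : F) ≠ 0) (m : AltPow F (Matrix ι ι F) 3)
    (i j : ι) : Q3 m (fun _ => j) (fun _ => i) = 0 := by
  have := Q3_perm m (Equiv.swap 0 1) (fun _ => j) (fun _ => i)
  rw [Equiv.Perm.sign_swap (by decide)] at this
  change Q3 m (fun _ => j) (fun _ => i) = _ at this
  have h : (2 : F) * Q3 m (fun _ => j) (fun _ => i) = 0 := by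
    rw [two_mul]
    nth_rewrite 1 [this]
    simp
  exact (mul_eq_zero.1 h).resolve_left h2

theorem h1_big (hq : 5 ≤ Fintype.card F) (h2 : (2 : F) ≠ 0) (h3 : (3 : F) ≠ 0)
    (h7 : (7 : F) ≠ 0 ∨ (26 : F) ≠ 0) (hn : 3 ≤ n)
    (c : GL (Fin n) F → AltPow F (Matrix (Fin n) (Fin n) F) 3)
    (hc : ∀ g h, c (g * h) = altPowRep F _ 3 (glConj F n) g (c h) + c g) :
    ∃ m, ∀ g, c g = altPowRep F _ 3 (glConj F n) g m - m :=
  h1_generic le_rfl (altPowRep F _ 3 (glConj F n)) Q3 R3 (R3_Q3 h2 h3) Q3_equiv R3_equiv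
    (fun _ m i j _ => Q3_top h2 m i j) h2 h3 h7
    (fun _ hd => main3 hq (by simpa using hn) hd) c hc

end Models2

set_option linter.unusedSectionVars false
set_option linter.unusedSimpArgs false
section H0big

variable {F : Type} [Field F] [Fintype F] {ι : Type} [Fintype ι] [DecidableEq ι]

lemma one_dim {M : Type} [AddCommGroup M] [Module F M] (N : Submodule F M) (v : M) (hv : v ∈ N)
    (f : M →ₗ[F] F) (hf : ∀ w ∈ N, f w = 0 → w = 0) (hfv : f v ≠ 0) : Module.finrank F N = 1 := by
  rw [finrank_eq_one_iff']
  refine ⟨⟨v, hv⟩, ?_, ?_⟩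
  · intro h
    have : v = 0 := congrArg Subtype.val h
    rw [this, map_zero] at hfv
    exact hfv rfl
  · rintro ⟨w, hw⟩
    refine ⟨f w / f v, ?_⟩
    apply Subtype.ext
    change (f w / f v) • v = w
    rw [← sub_eq_zero]
    apply hf _ (N.sub_mem (N.smul_mem _ hv) hw)
    rw [map_sub, map_smul, smul_eq_mul, div_mul_cancel₀ _ hfv, sub_self]

/-- permutation of tensor slots -/
def PS (F : Type) [Field F] (ι : Type) [DecidableEq ι] (σ : Equiv.Perm (Fin 3)) :
    Matrix (Fin 3 → ι) (Fin 3 → ι) F :=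
  Matrix.of fun I J => if I = J ∘ σ then 1 else 0

lemma PS_apply (σ : Equiv.Perm (Fin 3)) (I J : Fin 3 → ι) :
    PS F ι σ I J = if I = J ∘ σ then 1 else 0 := rfl

lemma PS_comm (σ : Equiv.Perm (Fin 3)) (g : Matrix ι ι F) : PS F ι σ * K g = K g * PS F ι σ := by
  ext I J
  simp only [Matrix.mul_apply, PS_apply]
  rw [Finset.sum_eq_single (I ∘ σ.symm), Finset.sum_eq_single (J ∘ σ)]
  · have : I = (I ∘ σ.symm) ∘ σ := by ext s; simp
    rw [if_pos this, if_pos rfl, one_mul, mul_one, K_apply, K_apply]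
    rw [← Equiv.prod_comp σ]
    simp
  · intro L _ hL; rw [if_neg hL, mul_zero]
  · simp
  · intro L _ hL
    rw [if_neg, zero_mul]
    intro h
    apply hL
    rw [h]; ext s; simp
  · simp

lemma comm_form (h2 : (2 : F) ≠ 0) (hq : 5 ≤ Fintype.card F) (hn : 3 ≤ Fintype.card ι) (J0 : Fin 3 → ι)
    (hJ : Function.Injective J0) (x : Matrix (Fin 3 → ι) (Fin 3 → ι) F)
    (hx : ∀ g : GL ι F, x * K (g : Matrix ι ι F) = K (g : Matrix ι ι F) * x) :
    x = ∑ σ : Equiv.Perm (Fin 3), x (J0 ∘ σ) J0 • PS F ι σ := by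
  have hsupp : ∀ I, (∀ σ : Equiv.Perm (Fin 3), I ≠ J0 ∘ σ) → x I J0 = 0 := by
    intro I hI
    have : ∃ s, cnt (J0 s) I = 0 := by
      by_contra hc
      push Not at hc
      have : ∀ s, ∃ r, I r = J0 s := by
        intro s
        obtain ⟨r, hr⟩ := Finset.card_pos.1 (Nat.pos_of_ne_zero (hc s))
        exact ⟨r, by simpa using hr⟩
      choose τ hτ using this
      have hinj : Function.Injective τ := by
        intro s s' h
        apply hJ
        rw [← hτ, ← hτ, h]
      let e := Equiv.ofBijective τ (Finite.injective_iff_bijective.1 hinj)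
      apply hI e.symm
      ext r
      have := hτ (e.symm r)
      rw [Function.comp_apply, ← this]
      congr 1
      exact (e.apply_symm_apply r).symm
    obtain ⟨s, hs⟩ := this
    have h := congrFun (congrFun (hx (dg (Function.update 1 (J0 s) (Units.mk0 2 h2)))) I) J0
    rw [dg_val, K_diagonal, Matrix.mul_diagonal, Matrix.diagonal_mul, prod_update, prod_update, hs,
      cnt_one J0 hJ s] at h
    simp only [Units.val_mk0, pow_one, pow_zero, one_mul] at h
    have : x I J0 * (2 - 1) = 0 := by rw [mul_sub, h]; ring
    norm_num at this
    exact this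
  rw [← sub_eq_zero]
  set y := x - ∑ σ : Equiv.Perm (Fin 3), x (J0 ∘ σ) J0 • PS F ι σ with hy
  have hyc : ∀ g : GL ι F, y * K (g : Matrix ι ι F) = K (g : Matrix ι ι F) * y := by
    intro g
    rw [hy, sub_mul, mul_sub, hx, Finset.sum_mul, Finset.mul_sum]
    congr 1
    refine Finset.sum_congr rfl fun σ _ => ?_
    rw [Matrix.smul_mul, Matrix.mul_smul, PS_comm]
  apply span3 hq hn J0 hJ
  intro g
  rw [← K_e0, Matrix.mulVec_mulVec, hyc, ← Matrix.mulVec_mulVec]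
  have : Matrix.mulVec y (Pi.single J0 1) = 0 := by
    ext I
    rw [Matrix.mulVec_single_one, Matrix.col_apply, hy, Matrix.sub_apply, Matrix.sum_apply]
    simp only [Matrix.smul_apply, PS_apply, smul_eq_mul, Pi.zero_apply]
    by_cases hI : ∃ σ : Equiv.Perm (Fin 3), I = J0 ∘ σ
    · obtain ⟨σ, rfl⟩ := hI
      rw [Finset.sum_eq_single σ]
      · simp
      · intro τ _ hτ
        rw [if_neg, mul_zero]
        intro h
        apply hτ
        ext1 s
        exact hJ (congrFun h s).symm
      · simp
    · push Not at hI
      rw [hsupp I hI, Finset.sum_eq_zero]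
      · simp
      · intro σ _
        rw [if_neg (hI σ), mul_zero]
  rw [this, Matrix.mulVec_zero]

lemma perm_cases : ∀ σ : Equiv.Perm (Fin 3),
    (∃ i j : Fin 3, i ≠ j ∧ (Equiv.swap i j)⁻¹ * σ * Equiv.swap i j = σ) ∨ σ = finRotate 3 ∨
      ∃ i j : Fin 3, i ≠ j ∧ (Equiv.swap i j)⁻¹ * finRotate 3 * Equiv.swap i j = σ := by
  decide

lemma sum_sign : ∑ σ : Equiv.Perm (Fin 3), (Equiv.Perm.sign σ : ℤ) *
    (if finRotate 3 * σ⁻¹ = σ⁻¹ * finRotate 3 then 1 else 0) = 3 := by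
  decide

lemma comm_zero (h2 : (2 : F) ≠ 0) (hq : 5 ≤ Fintype.card F) (hn : 3 ≤ Fintype.card ι) (J0 : Fin 3 → ι)
    (hJ : Function.Injective J0) (m : AltPow F (Matrix ι ι F) 3)
    (hx : ∀ g : GL ι F, Q3 m * K (g : Matrix ι ι F) = K (g : Matrix ι ι F) * Q3 m)
    (h0 : Q3 m (J0 ∘ finRotate 3) J0 = 0) : Q3 m = 0 := by
  have hform := comm_form h2 hq hn J0 hJ (Q3 m) hx
  set a : Equiv.Perm (Fin 3) → F := fun σ => Q3 m (J0 ∘ σ) J0 with ha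
  have hconj : ∀ σ τ, a (τ⁻¹ * σ * τ) = (Equiv.Perm.sign τ : ℤˣ) • a σ := by
    intro σ τ
    have h := Q3_perm m τ (J0 ∘ σ) J0
    have h1 : Q3 m ((J0 ∘ σ) ∘ τ) (J0 ∘ τ) = a (τ⁻¹ * σ * τ) := by
      rw [hform, Matrix.sum_apply, Finset.sum_eq_single (τ⁻¹ * σ * τ)]
      · rw [Matrix.smul_apply, PS_apply, if_pos, smul_eq_mul, mul_one]
        ext s
        simp
      · intro ρ _ hρ
        rw [Matrix.smul_apply, PS_apply, if_neg, smul_zero]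
        intro h
        apply hρ
        ext1 s
        have := hJ (congrFun h s)
        change σ (τ s) = τ (ρ s) at this
        simp [this]
      · simp
    rw [← h1]; exact h
  have hneg : ∀ i j : Fin 3, i ≠ j → ∀ σ, a ((Equiv.swap i j)⁻¹ * σ * Equiv.swap i j) = - a σ := by
    intro i j hij σ
    rw [hconj, Equiv.Perm.sign_swap hij]; simp
  have hz : ∀ σ, a σ = 0 := by
    intro σ
    rcases perm_cases σ with ⟨i, j, hij, h⟩ | h | ⟨i, j, hij, h⟩
    · have := hneg i j hij σ
      rw [h] at this
      have h4 : 2 * a σ = 0 := by rw [two_mul]; nth_rewrite 1 [this]; simp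
      exact (mul_eq_zero.1 h4).resolve_left h2
    · rw [h]; exact h0
    · rw [← h, hneg i j hij, neg_eq_zero]; exact h0
  rw [hform]
  apply Finset.sum_eq_zero
  intro σ _
  change a σ • _ = _
  rw [hz, zero_smul]

lemma Q3_R3 (x : Matrix (Fin 3 → ι) (Fin 3 → ι) F) (I J : Fin 3 → ι) :
    Q3 (R3 x) I J = (6 : F)⁻¹ * ∑ σ : Equiv.Perm (Fin 3),
      ((Equiv.Perm.sign σ : ℤ) : F) * x (I ∘ ⇑σ⁻¹) (J ∘ ⇑σ⁻¹) := by
  have : (Matrix.entryLinearMap F F I J).comp (Q3.comp R3) =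
      (6 : F)⁻¹ • ∑ σ : Equiv.Perm (Fin 3),
        ((Equiv.Perm.sign σ : ℤ) : F) • Matrix.entryLinearMap F F (I ∘ ⇑σ⁻¹) (J ∘ ⇑σ⁻¹) := by
    refine ext_outer fun A => ?_
    simp only [LinearMap.comp_apply, R3_outer, map_smul, Q3_mkA, LinearMap.smul_apply,
      LinearMap.sum_apply, Matrix.entryLinearMap_apply, Matrix.sum_apply, Matrix.smul_apply]
    congr 1
    refine Finset.sum_congr rfl fun σ _ => ?_
    rw [outer_apply, outer_apply, ← Equiv.prod_comp σ⁻¹]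
    simp [Units.smul_def]
  have := LinearMap.congr_fun this x
  simpa using this

theorem h0_big {n : ℕ} (hq : 5 ≤ Fintype.card F) (h2 : (2 : F) ≠ 0) (h3 : (3 : F) ≠ 0) (hn : 3 ≤ n) :
    Module.finrank F (altPowRep F _ 3 (glConj F n)).invariants = 1 := by
  obtain ⟨J0, hJ0⟩ : ∃ J0 : Fin 3 → Fin n, Function.Injective J0 :=
    ⟨Fin.castLE hn, Fin.castLE_injective hn⟩
  refine one_dim _ (R3 (PS F (Fin n) (finRotate 3))) ?_
    ((Matrix.entryLinearMap F F (J0 ∘ finRotate 3) J0).comp Q3) ?_ ?_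
  · rw [Representation.mem_invariants]
    intro g
    rw [← R3_equiv, ← PS_comm, Matrix.mul_assoc, ← K_mul, ← Units.val_mul, mul_inv_cancel,
      Units.val_one, K_one, Matrix.mul_one]
  · intro w hw h0
    rw [Representation.mem_invariants] at hw
    have : Q3 w = 0 := by
      refine comm_zero h2 hq (by simpa using hn) J0 hJ0 w ?_ h0
      intro g
      rw [← Q3_equiv, hw g]
    rw [← R3_Q3 h2 h3 w, this, map_zero]
  · have h6 : (6 : F) ≠ 0 := by
      rw [show (6 : F) = 2 * 3 by norm_num]; exact mul_ne_zero h2 h3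
    rw [LinearMap.comp_apply, Matrix.entryLinearMap_apply, Q3_R3]
    apply mul_ne_zero (inv_ne_zero h6)
    have h := congrArg (Int.cast : ℤ → F) sum_sign
    push_cast at h
    have e : ∀ σ : Equiv.Perm (Fin 3), PS F (Fin n) (finRotate 3) ((J0 ∘ finRotate 3) ∘ ⇑σ⁻¹) (J0 ∘ ⇑σ⁻¹)
        = if finRotate 3 * σ⁻¹ = σ⁻¹ * finRotate 3 then 1 else 0 := by
      intro σ
      rw [PS_apply]
      congr 1
      apply propext
      constructor
      · intro h
        ext1 s
        exact hJ0 (congrFun h s)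
      · intro h
        ext1 s
        exact congrArg J0 (DFunLike.congr_fun h s)
    simp only [e]
    rw [h]
    exact h3

end H0big

set_option linter.unusedSectionVars false
set_option linter.unusedSimpArgs false
section N2

variable {F : Type} [Field F] [Fintype F]

def S2 : AltPow F (Matrix (Fin 2) (Fin 2) F) 3 →ₗ[F] Matrix (Fin 2) (Fin 2) F :=
  liftA (MultilinearMap.alternatization (MultilinearMap.mkPiAlgebraFin F 3 (Matrix (Fin 2) (Fin 2) F)))

lemma S2_mkA' (v : Fin 3 → Matrix (Fin 2) (Fin 2) F) : S2 (mkA F (Matrix (Fin 2) (Fin 2) F) v) =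
    ∑ σ : Equiv.Perm (Fin 3), (Equiv.Perm.sign σ : ℤˣ) • (v (σ 0) * v (σ 1) * v (σ 2)) := by
  rw [S2, liftA_mkA, altern_apply]
  refine Finset.sum_congr rfl fun σ _ => ?_
  simp [Matrix.mul_assoc, List.ofFn_succ]

lemma univ6 : (Finset.univ : Finset (Equiv.Perm (Fin 3))) =
    {1, Equiv.swap 0 1, Equiv.swap 0 2, Equiv.swap 1 2, finRotate 3, (finRotate 3)⁻¹} := by decide

lemma S2_mkA (A B C : Matrix (Fin 2) (Fin 2) F) : S2 (mkA F (Matrix (Fin 2) (Fin 2) F) ![A, B, C]) =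
    A * B * C - B * A * C - C * B * A - A * C * B + B * C * A + C * A * B := by
  rw [S2_mkA', univ6]
  have e1 : (finRotate 3)⁻¹ 0 = 2 := by decide
  have e2 : (finRotate 3)⁻¹ 1 = 0 := by decide
  have e3 : (finRotate 3)⁻¹ 2 = 1 := by decide
  have e4 : (finRotate 3) 0 = 1 := by decide
  have e5 : (finRotate 3) 1 = 2 := by decide
  have e6 : (finRotate 3) 2 = 0 := by decide
  have f1 : Equiv.swap (0 : Fin 3) 1 2 = 2 := by decide
  have f2 : Equiv.swap (0 : Fin 3) 2 1 = 1 := by decide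
  have f3 : Equiv.swap (1 : Fin 3) 2 0 = 0 := by decide
  have s1 : Equiv.Perm.sign (finRotate 3) = 1 := by decide
  have s2 : Equiv.Perm.sign (finRotate 3)⁻¹ = 1 := by decide
  have t1 : Equiv.Perm.sign (Equiv.swap (0 : Fin 3) 1) = -1 := by decide
  have t2 : Equiv.Perm.sign (Equiv.swap (0 : Fin 3) 2) = -1 := by decide
  have t3 : Equiv.Perm.sign (Equiv.swap (1 : Fin 3) 2) = -1 := by decide
  rw [Finset.sum_insert (by decide), Finset.sum_insert (by decide), Finset.sum_insert (by decide),
    Finset.sum_insert (by decide), Finset.sum_insert (by decide), Finset.sum_singleton]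
  simp only [e1, e2, e3, e4, e5, e6, f1, f2, f3, s1, s2, t1, t2, t3, Equiv.swap_apply_left,
    Equiv.swap_apply_right, Equiv.Perm.sign_one, Equiv.Perm.one_apply, one_smul, Units.neg_smul]
  simp only [Matrix.cons_val]
  abel

lemma S2_equiv (g : GL (Fin 2) F) (m) :
    S2 (altPowRep F _ 3 (glConj F 2) g m) =
      (g : Matrix (Fin 2) (Fin 2) F) * S2 m * ((g⁻¹ : GL (Fin 2) F) : Matrix (Fin 2) (Fin 2) F) := by
  have : S2.comp (altPowRep F _ 3 (glConj F 2) g) =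
      ((LinearMap.mulRight F (((g⁻¹ : GL (Fin 2) F) : Matrix (Fin 2) (Fin 2) F))).comp
        (LinearMap.mulLeft F ((g : Matrix (Fin 2) (Fin 2) F)))).comp S2 := by
    refine extA fun A => ?_
    simp only [LinearMap.comp_apply, altPowRep_mkA, S2_mkA', LinearMap.mulRight_apply, LinearMap.mulLeft_apply]
    rw [Finset.mul_sum, Finset.sum_mul]
    refine Finset.sum_congr rfl fun σ _ => ?_
    rw [mul_smul_comm, smul_mul_assoc]
    congr 1
    simp only [glConj_apply, Matrix.mul_assoc]
    have h : ∀ X : Matrix (Fin 2) (Fin 2) F,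
        ((g⁻¹ : GL (Fin 2) F) : Matrix (Fin 2) (Fin 2) F) * ((g : Matrix (Fin 2) (Fin 2) F) * X) = X := by
      intro X
      rw [← Matrix.mul_assoc, ← Units.val_mul, inv_mul_cancel, Units.val_one, Matrix.one_mul]
    simp only [h]
  exact LinearMap.congr_fun this m

lemma S2_surj (h3 : (3 : F) ≠ 0) : Function.Surjective (S2 (F := F)) := by
  intro x
  refine ⟨x 0 1 • mkA F (Matrix (Fin 2) (Fin 2) F) ![!![1, 0; 0, 0], !![0, 1; 0, 0], !![0, 0; 0, 1]]
    + x 1 0 • mkA F (Matrix (Fin 2) (Fin 2) F) ![!![0, 0; 0, 1], !![0, 0; 1, 0], !![1, 0; 0, 0]]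
    + ((2 * x 0 0 - x 1 1) / 3) • mkA F (Matrix (Fin 2) (Fin 2) F) ![!![1, 0; 0, 0], !![0, 1; 0, 0], !![0, 0; 1, 0]]
    + ((2 * x 1 1 - x 0 0) / 3) • mkA F (Matrix (Fin 2) (Fin 2) F) ![!![0, 0; 0, 1], !![0, 0; 1, 0], !![0, 1; 0, 0]], ?_⟩
  simp only [map_add, map_smul, S2_mkA, Matrix.mul_fin_two]
  ext i j
  fin_cases i <;> fin_cases j <;> simp <;> field_simp <;> ring

lemma finrank_alt2 : Module.Finite F (AltPow F (Matrix (Fin 2) (Fin 2) F) 3) ∧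
    Module.finrank F (AltPow F (Matrix (Fin 2) (Fin 2) F) 3) ≤ 4 := by
  let φ := exteriorPower.alternatingMapLinearEquiv (mkA F (Matrix (Fin 2) (Fin 2) F))
  have hs : Function.Surjective φ := by
    rw [← LinearMap.range_eq_top, ← Submodule.ker_mkQ (LinearMap.range φ), LinearMap.ker_eq_top]
    refine extA fun v => ?_
    rw [LinearMap.zero_apply, ← exteriorPower.alternatingMapLinearEquiv_apply_ιMulti (R := F)]
    rw [Submodule.mkQ_apply, Submodule.Quotient.mk_eq_zero]
    exact ⟨_, rfl⟩
  refine ⟨Module.Finite.of_surjective φ hs, ?_⟩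
  refine (LinearMap.finrank_le_finrank_of_surjective hs).trans ?_
  rw [exteriorPower.finrank_eq, Module.finrank_matrix]
  simp

def S2e (h3 : (3 : F) ≠ 0) : AltPow F (Matrix (Fin 2) (Fin 2) F) 3 ≃ₗ[F] Matrix (Fin 2) (Fin 2) F :=
  LinearEquiv.ofBijective S2 (by
    have := (finrank_alt2 (F := F)).1
    refine ⟨?_, S2_surj h3⟩
    refine (LinearMap.injective_iff_surjective_of_finrank_eq_finrank ?_).2 (S2_surj h3)
    refine le_antisymm ((finrank_alt2 (F := F)).2.trans ?_)
      (LinearMap.finrank_le_finrank_of_surjective (S2_surj h3))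
    rw [Module.finrank_matrix]
    simp)

lemma S2e_apply (h3 : (3 : F) ≠ 0) (m) : S2e h3 m = S2 m := rfl

def E2 (F : Type) [Field F] : Matrix (Fin 2) (Fin 2) F ≃ₐ[F] Matrix (Fin 1 → Fin 2) (Fin 1 → Fin 2) F :=
  Matrix.reindexAlgEquiv F F (Equiv.funUnique (Fin 1) (Fin 2)).symm

lemma E2_K (g : Matrix (Fin 2) (Fin 2) F) : E2 F g = K g := by
  ext I J
  simp [E2, K_apply]

theorem h1_two (hq : 5 ≤ Fintype.card F) (h2 : (2 : F) ≠ 0) (h3 : (3 : F) ≠ 0)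
    (h7 : (7 : F) ≠ 0 ∨ (26 : F) ≠ 0)
    (c : GL (Fin 2) F → AltPow F (Matrix (Fin 2) (Fin 2) F) 3)
    (hc : ∀ g h, c (g * h) = altPowRep F _ 3 (glConj F 2) g (c h) + c g) :
    ∃ m, ∀ g, c g = altPowRep F _ 3 (glConj F 2) g m - m := by
  refine h1_generic (a := 1) (by norm_num) (altPowRep F _ 3 (glConj F 2))
    ((E2 F).toLinearMap.comp (S2e h3).toLinearMap)
    ((S2e h3).symm.toLinearMap.comp (E2 F).symm.toLinearMap)
    ?_ ?_ ?_ (fun h => by omega) h2 h3 h7 (fun _ hd => main1 hq 0 hd) c hc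
  · intro m; simp
  · intro g m
    simp only [LinearMap.comp_apply, AlgEquiv.toLinearMap_apply, LinearEquiv.coe_coe, S2e_apply, S2_equiv]
    rw [← E2_K, ← map_mul, ← map_mul, Matrix.mul_assoc, ← Units.val_mul, inv_mul_cancel,
      Units.val_one, Matrix.mul_one]
  · intro g x
    simp only [LinearMap.comp_apply, AlgEquiv.toLinearMap_apply, LinearEquiv.coe_coe]
    rw [LinearEquiv.symm_apply_eq, S2e_apply, S2_equiv, ← S2e_apply h3, LinearEquiv.apply_symm_apply,
      ← E2_K, ← E2_K, map_mul, map_mul, AlgEquiv.symm_apply_apply, AlgEquiv.symm_apply_apply]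

theorem h0_two (h3 : (3 : F) ≠ 0) :
    Module.finrank F (altPowRep F _ 3 (glConj F 2)).invariants = 1 := by
  refine one_dim _ ((S2e h3).symm 1) ?_
    ((Matrix.entryLinearMap F F (0 : Fin 2) (0 : Fin 2)).comp S2) ?_ ?_
  · rw [Representation.mem_invariants]
    intro g
    rw [LinearEquiv.eq_symm_apply, S2e_apply, S2_equiv, ← S2e_apply h3, LinearEquiv.apply_symm_apply,
      Matrix.mul_one, ← Units.val_mul, mul_inv_cancel, Units.val_one]
  · intro w hw h0
    rw [Representation.mem_invariants] at hw
    have hcomm : ∀ g : GL (Fin 2) F, (g : Matrix (Fin 2) (Fin 2) F) * S2 w = S2 w * (g : Matrix (Fin 2) (Fin 2) F) := by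
      intro g
      conv_rhs => rw [← hw g]
      rw [S2_equiv, Matrix.mul_assoc, ← Units.val_mul, inv_mul_cancel, Units.val_one, Matrix.mul_one]
    have : S2 w ∈ Set.range (Matrix.scalar (Fin 2)) := by
      apply Matrix.mem_range_scalar_of_commute_single
      intro i j hij
      have h := hcomm (Matrix.GeneralLinearGroup.mkOfDetNeZero (Matrix.transvection i j (1 : F))
        (by rw [Matrix.det_transvection_of_ne _ _ hij]; exact one_ne_zero))
      change Matrix.transvection i j (1 : F) * _ = _ * Matrix.transvection i j (1 : F) at h
      rw [Matrix.transvection, add_mul, mul_add, Matrix.one_mul, Matrix.mul_one] at h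
      exact add_left_cancel h
    obtain ⟨a, ha⟩ := this
    have : a = 0 := by
      have h : S2 w 0 0 = 0 := h0
      rw [← ha] at h
      simpa using h
    rw [this, map_zero] at ha
    apply (S2e h3).injective
    rw [S2e_apply, ← ha, map_zero]
  · rw [LinearMap.comp_apply, ← S2e_apply h3, LinearEquiv.apply_symm_apply]
    simp

end N2

end GLX
/-- Low-degree cohomology of `GL(n,k)` with coefficients in `Λ³(gl_n)`,
for `k` finite of characteristic `p ≥ 5` and `n ≥ 2`. -/
theorem gl_cohomology_ext3_low_degrees
    (k : Type) [Field k] [Fintype k] (p : ℕ) [CharP k p] (hp : 5 ≤ p)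
    (n : ℕ) (hn : 2 ≤ n) :
    Module.finrank k (groupCohomology (Rep.of (altPowRep k (Matrix (Fin n) (Fin n) k) 3 (glConj k n))) 0) = 1 ∧
    Subsingleton (groupCohomology (Rep.of (altPowRep k (Matrix (Fin n) (Fin n) k) 3 (glConj k n))) 1) := by
  have hpp : p.Prime := (CharP.char_is_prime_or_zero k p).resolve_right (by omega)
  have hne : ∀ m : ℕ, 0 < m → m < p → (m : k) ≠ 0 := by
    intro m h0 hm h
    have := (CharP.cast_eq_zero_iff k p m).1 h
    exact absurd (Nat.le_of_dvd h0 this) (by omega)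
  have h2 : (2 : k) ≠ 0 := by exact_mod_cast hne 2 (by norm_num) (by omega)
  have h3 : (3 : k) ≠ 0 := by exact_mod_cast hne 3 (by norm_num) (by omega)
  have h7 : (7 : k) ≠ 0 ∨ (26 : k) ≠ 0 := by
    by_contra hcon
    push Not at hcon
    obtain ⟨a, b⟩ := hcon
    have h1 : ((1 : ℕ) : k) = 0 := by push_cast; linear_combination 15 * a - 4 * b
    exact hne 1 (by norm_num) (by omega) h1
  have hq : 5 ≤ Fintype.card k := by
    have : p ∣ Fintype.card k := (CharP.cast_eq_zero_iff k p _).1 (FiniteField.cast_card_eq_zero k)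
    exact hp.trans (Nat.le_of_dvd Fintype.card_pos this)
  have H0 : Module.finrank k (altPowRep k _ 3 (glConj k n)).invariants = 1 := by
    rcases Nat.lt_or_ge n 3 with h | h
    · obtain rfl : n = 2 := by omega
      exact GLX.h0_two h3
    · exact GLX.h0_big hq h2 h3 h
  have H1 : ∀ c : GL (Fin n) k → AltPow k (Matrix (Fin n) (Fin n) k) 3,
      (∀ g h, c (g * h) = altPowRep k _ 3 (glConj k n) g (c h) + c g) →
      ∃ m, ∀ g, c g = altPowRep k _ 3 (glConj k n) g m - m := by
    rcases Nat.lt_or_ge n 3 with h | h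
    · obtain rfl : n = 2 := by omega
      exact GLX.h1_two hq h2 h3 h7
    · exact GLX.h1_big hq h2 h3 h7 h
  constructor
  · rw [← H0]
    exact LinearEquiv.finrank_eq
      (groupCohomology.H0Iso (Rep.of (altPowRep k (Matrix (Fin n) (Fin n) k) 3 (glConj k n)))).toLinearEquiv
  · refine subsingleton_of_forall_eq 0 fun x => ?_
    induction x using groupCohomology.H1_induction_on with
    | h c =>
      rw [groupCohomology.H1π_eq_zero_iff]
      obtain ⟨m, hm⟩ := H1 c (fun g h => (groupCohomology.mem_cocycles₁_iff _).1 c.2 g h)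
      exact ⟨m, funext fun g => (hm g).symm⟩
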